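/- arXiv:1905.13615 — 3 statements merged into one kernel-verified Lean document; each statement's English description precedes it below -/
import Mathlib

section
/- Let ν be a probability measure on ℝ, let s, t > 0, and let (X_u)_{u ≥ 0} be a stochastic process such that X_0 and X_t both have law ν and |X_t − X_0| is (essentially) bounded. Let Z be a standard normal random variable independent of the process, let F_t = e^{-t} X_0 + √(1 − e^{-2t}) Z, and let τ_t := Σ_{k ≥ 1} (e^{-kt}/(s · k! · (1 − e^{-2t})^{(k−1)/2})) E[(X_t − X_0)^k | X_0] H_{k−1}(Z). Then E[τ_t | F_t] = 0 almost surely. -/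
open MeasureTheory ProbabilityTheory Real
open scoped ENNReal NNReal BigOperators Topology Classical

noncomputable section

/-- `ℝ^d` with the Euclidean norm. -/
abbrev Euc (d : ℕ) := EuclideanSpace ℝ (Fin d)

/-- The standard Gaussian measure on `ℝ^d`. -/
def stdGaussian (d : ℕ) : Measure (Euc d) :=
  volume.withDensity fun x =>
    ENNReal.ofReal ((2 * Real.pi) ^ (-(d : ℝ) / 2) * Real.exp (-‖x‖ ^ 2 / 2))

/-- The Wasserstein distance of order `p` between two measures, valued in `ℝ≥0∞`. -/
def wassersteinDist {E : Type*} [NormedAddCommGroup E] [MeasurableSpace E]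
    (p : ℝ) (μ ν : Measure E) : ℝ≥0∞ :=
  ⨅ (cpl : Measure (E × E)) (_ : IsProbabilityMeasure cpl)
    (_ : cpl.map Prod.fst = μ) (_ : cpl.map Prod.snd = ν),
    (∫⁻ q, ENNReal.ofReal (‖q.1 - q.2‖ ^ p) ∂cpl) ^ (1 / p)

/-- Degree `|α|` of a multi-index. -/
def mdeg {d : ℕ} (α : Fin d → ℕ) : ℕ := ∑ i, α i

/-- Factorial `α!` of a multi-index. -/
def mfact {d : ℕ} (α : Fin d → ℕ) : ℕ := ∏ i, (α i).factorial

/-- Monomial `x^α`. -/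
def monoE {d : ℕ} (α : Fin d → ℕ) (x : Euc d) : ℝ := ∏ i, x i ^ α i

/-- The family indexed by multi-indices of degree 2 associated with the identity matrix. -/
def idFam {d : ℕ} (α : Fin d → ℕ) : ℝ := if ∃ i : Fin d, α = Pi.single i 2 then 1 else 0

/-- Partial derivative in the `i`-th coordinate direction. -/
def pderivE {d : ℕ} (i : Fin d) (f : Euc d → ℝ) : Euc d → ℝ :=
  fun x => fderiv ℝ f x (EuclideanSpace.single i 1)

/-- Iterated partial derivative `∂^α`. -/
def mderivE {d : ℕ} (α : Fin d → ℕ) (f : Euc d → ℝ) : Euc d → ℝ :=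
  ((List.ofFn fun i : Fin d => (pderivE i)^[α i]).foldr (· ∘ ·) id) f

/-- `∂^α` applied componentwise to a vector field. -/
def mderivVec {d : ℕ} (α : Fin d → ℕ) (g : Euc d → Euc d) (x : Euc d) : Euc d :=
  (EuclideanSpace.equiv (Fin d) ℝ).symm fun i => mderivE α (fun y => g y i) x

/-- The Ornstein-Uhlenbeck semigroup `P_t`. -/
def OU {d : ℕ} (t : ℝ) (φ : Euc d → ℝ) (x : Euc d) : ℝ :=
  ∫ y, φ (Real.exp (-t) • x + Real.sqrt (1 - Real.exp (-2 * t)) • y) ∂(stdGaussian d)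

/-- The Ornstein-Uhlenbeck semigroup acting componentwise on a vector field. -/
def OUvec {d : ℕ} (t : ℝ) (g : Euc d → Euc d) (x : Euc d) : Euc d :=
  ∫ y, g (Real.exp (-t) • x + Real.sqrt (1 - Real.exp (-2 * t)) • y) ∂(stdGaussian d)

/-- The `k`-th probabilists' Hermite polynomial, as a function `ℝ → ℝ`. -/
def hermiteR (k : ℕ) (x : ℝ) : ℝ := Polynomial.aeval x (Polynomial.hermite k)

/-- The multivariate Hermite polynomial `H_α`. -/
def hermiteM {d : ℕ} (α : Fin d → ℕ) (x : Euc d) : ℝ := ∏ i, hermiteR (α i) (x i)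

/-- The Hilbert–Schmidt norm of the matrix `E[Y Yᵀ]`. -/
def covHS {Ω : Type*} [MeasurableSpace Ω] {d : ℕ} (P : Measure Ω) (Y : Ω → Euc d) : ℝ :=
  Real.sqrt (∑ k, ∑ l, (∫ ω, Y ω k * Y ω l ∂P) ^ 2)

/-- The Hilbert–Schmidt norm of the matrix `E[Y Yᵀ ‖Y‖^l]`. -/
def covHSw {Ω : Type*} [MeasurableSpace Ω] {d : ℕ} (P : Measure Ω) (Y : Ω → Euc d) (l : ℝ) : ℝ :=
  Real.sqrt (∑ k, ∑ k', (∫ ω, Y ω k * Y ω k' * ‖Y ω‖ ^ l ∂P) ^ 2)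

/-- The derivatives of `w ↦ exp (w z - w² / 2)` are given by Hermite polynomials. -/
theorem iteratedDeriv_cexp_hermite (z : ℂ) (n : ℕ) :
    iteratedDeriv n (fun w : ℂ => Complex.exp (w * z - w ^ 2 / 2)) =
      fun w => Polynomial.aeval (z - w) (Polynomial.hermite n) *
        Complex.exp (w * z - w ^ 2 / 2) := by
  induction n with
  | zero => simp
  | succ n ih =>
    rw [iteratedDeriv_succ, ih]
    funext w
    have h1 : HasDerivAt (fun w : ℂ => Polynomial.aeval (z - w) (Polynomial.hermite n))
        (Polynomial.aeval (z - w) (Polynomial.derivative (Polynomial.hermite n)) * (-1)) w :=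
      (Polynomial.hasDerivAt_aeval (Polynomial.hermite n) (z - w)).comp w
        ((hasDerivAt_id w).const_sub z)
    have h2 : HasDerivAt (fun w : ℂ => w * z - w ^ 2 / 2) (z - w) w := by
      refine (((hasDerivAt_id w).mul_const z).sub
        (((hasDerivAt_id w).pow 2).div_const 2)).congr_deriv ?_
      simp
    have h3 : HasDerivAt (fun w : ℂ => Polynomial.aeval (z - w) (Polynomial.hermite n) *
        Complex.exp (w * z - w ^ 2 / 2)) _ w := h1.mul h2.cexp
    rw [h3.deriv, Polynomial.hermite_succ]
    simp only [map_sub, map_mul, Polynomial.aeval_X]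
    ring

theorem differentiable_cexp_hermite (z : ℂ) :
    Differentiable ℂ (fun w : ℂ => Complex.exp (w * z - w ^ 2 / 2)) := by
  fun_prop

theorem iteratedDeriv_cexp_hermite_zero (z : ℝ) (n : ℕ) :
    iteratedDeriv n (fun w : ℂ => Complex.exp (w * z - w ^ 2 / 2)) 0 = (hermiteR n z : ℂ) := by
  rw [iteratedDeriv_cexp_hermite]
  simp only [sub_zero, hermiteR]
  rw [← Complex.coe_algebraMap, Polynomial.aeval_algebraMap_apply]
  simp

/-- The exponential generating function of the Hermite polynomials. -/
theorem hasSum_hermiteR (v z : ℝ) :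
    HasSum (fun k : ℕ => v ^ k / k.factorial * hermiteR k z) (Real.exp (v * z - v ^ 2 / 2)) := by
  have h := Complex.hasSum_taylorSeries_of_entire (differentiable_cexp_hermite z) 0 (v : ℂ)
  simp only [iteratedDeriv_cexp_hermite_zero, sub_zero, smul_eq_mul] at h
  rw [← Complex.hasSum_ofReal]
  push_cast
  refine h.congr_fun fun k => ?_
  ring

/-- Cauchy estimate for the Hermite polynomials. -/
theorem abs_hermiteR_le (k : ℕ) (z : ℝ) {R : ℝ} (hR : 0 < R) :
    |hermiteR k z| ≤ k.factorial / R ^ k * Real.exp (R * |z| + R ^ 2 / 2) := by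
  have h := Complex.norm_iteratedDeriv_le_of_forall_mem_sphere_norm_le k hR
    (differentiable_cexp_hermite z).diffContOnCl
    (C := Real.exp (R * |z| + R ^ 2 / 2)) (c := 0) (fun w hw => by
      have hw' : ‖w‖ = R := by simpa using hw
      rw [Complex.norm_exp]
      refine Real.exp_le_exp.2 ((Complex.re_le_norm _).trans ((norm_sub_le _ _).trans ?_))
      simp [hw'])
  rw [iteratedDeriv_cexp_hermite_zero, Complex.norm_real, Real.norm_eq_abs] at h
  exact h.trans (le_of_eq (by ring))

theorem continuous_hermiteR (k : ℕ) : Continuous (hermiteR k) :=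
  (Polynomial.hermite k).continuous_aeval

/-- The integral `∫₀ᵘ exp (v z - v² / 2) dv`. -/
def hermitePrimitive (u z : ℝ) : ℝ := ∫ v in (0 : ℝ)..u, Real.exp (v * z - v ^ 2 / 2)

theorem continuous_hermitePrimitive : Continuous fun p : ℝ × ℝ => hermitePrimitive p.1 p.2 := by
  unfold hermitePrimitive
  exact intervalIntegral.continuous_parametric_intervalIntegral_of_continuous
    (f := fun (p : ℝ × ℝ) v => Real.exp (v * p.2 - v ^ 2 / 2)) (by fun_prop) continuous_fst

theorem abs_hermitePrimitive_le {u b : ℝ} (hu : |u| ≤ b) (z : ℝ) :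
    |hermitePrimitive u z| ≤ b * Real.exp (b * |z|) := by
  have h := intervalIntegral.norm_integral_le_of_norm_le_const (a := 0) (b := u)
    (f := fun v => Real.exp (v * z - v ^ 2 / 2)) (C := Real.exp (b * |z|)) (fun v hv => by
      rw [Real.norm_eq_abs, abs_of_pos (Real.exp_pos _)]
      refine Real.exp_le_exp.2 ?_
      have hv' : |v| ≤ b := by
        rcases Set.mem_uIoc.1 hv with h | h
        · exact (abs_le_abs_of_nonneg h.1.le h.2).trans hu
        · exact (abs_le_abs_of_nonpos h.2 h.1.le).trans hu
      have h1 : v * z ≤ b * |z| := (le_abs_self _).trans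
        (by rw [abs_mul]; exact mul_le_mul_of_nonneg_right hv' (abs_nonneg _))
      nlinarith [sq_nonneg v])
  rw [sub_zero, Real.norm_eq_abs] at h
  refine h.trans ?_
  rw [mul_comm]
  exact mul_le_mul_of_nonneg_right hu (Real.exp_pos _).le

/-- Domination of the terms of the series for `hermitePrimitive` by a geometric series. -/
theorem abs_hermite_term_le {m b : ℝ} (hb : 0 ≤ b) (k : ℕ) (z : ℝ) (hm : |m| ≤ b ^ (k + 1)) :
    |m / (k + 1).factorial * hermiteR k z| ≤
      (1 / 2) ^ k * (b * Real.exp ((2 * b + 1) * |z| + (2 * b + 1) ^ 2 / 2)) := by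
  set R := 2 * b + 1 with hRdef
  have hR : 0 < R := by positivity
  have hr : b / R ≤ 1 / 2 := by
    rw [div_le_div_iff₀ hR two_pos]; linarith
  rw [abs_mul, abs_div, Nat.abs_cast]
  calc |m| / (k + 1).factorial * |hermiteR k z|
      ≤ b ^ (k + 1) / k.factorial *
        (k.factorial / R ^ k * Real.exp (R * |z| + R ^ 2 / 2)) :=
        mul_le_mul (div_le_div₀ (by positivity) hm (by positivity)
          (by exact_mod_cast Nat.factorial_le k.le_succ)) (abs_hermiteR_le k z hR)
          (abs_nonneg _) (by positivity)
    _ = (b / R) ^ k * (b * Real.exp (R * |z| + R ^ 2 / 2)) := by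
        have : (k.factorial : ℝ) ≠ 0 := by positivity
        rw [div_pow]; field_simp; ring
    _ ≤ _ := by gcongr

theorem hasSum_hermitePrimitive (u z : ℝ) :
    HasSum (fun k : ℕ => u ^ (k + 1) / (k + 1).factorial * hermiteR k z)
      (hermitePrimitive u z) := by
  have h := intervalIntegral.hasSum_integral_of_dominated_convergence (μ := volume) (a := 0)
    (b := u) (F := fun (k : ℕ) v => v ^ k / k.factorial * hermiteR k z)
    (f := fun v => Real.exp (v * z - v ^ 2 / 2))
    (fun k _ => (1 / 2) ^ k *
      Real.exp ((2 * |u| + 1) * |z| + (2 * |u| + 1) ^ 2 / 2))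
    (fun k => by
      apply Continuous.aestronglyMeasurable
      fun_prop)
    (fun k => Filter.Eventually.of_forall fun v hv => by
      have hv' : |v| ≤ |u| := by
        rcases Set.mem_uIoc.1 hv with h | h
        · exact abs_le_abs_of_nonneg h.1.le h.2
        · exact abs_le_abs_of_nonpos h.2 h.1.le
      have hR : 0 < 2 * |u| + 1 := by positivity
      have hr : |v| / (2 * |u| + 1) ≤ 1 / 2 := by
        rw [div_le_div_iff₀ hR two_pos]; linarith
      rw [Real.norm_eq_abs, abs_mul, abs_div, abs_pow, Nat.abs_cast]
      calc |v| ^ k / k.factorial * |hermiteR k z|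
          ≤ |v| ^ k / k.factorial * (k.factorial / (2 * |u| + 1) ^ k *
            Real.exp ((2 * |u| + 1) * |z| + (2 * |u| + 1) ^ 2 / 2)) := by
            gcongr
            exact abs_hermiteR_le k z hR
        _ = (|v| / (2 * |u| + 1)) ^ k *
            Real.exp ((2 * |u| + 1) * |z| + (2 * |u| + 1) ^ 2 / 2) := by
            have : (k.factorial : ℝ) ≠ 0 := by positivity
            rw [div_pow]; field_simp
        _ ≤ _ := by gcongr)
    (Filter.Eventually.of_forall fun v _ => summable_geometric_two.mul_right _)
    (by simp)
    (Filter.Eventually.of_forall fun v _ => hasSum_hermiteR v z)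
  unfold hermitePrimitive
  refine h.congr_fun fun k => ?_
  rw [intervalIntegral.integral_mul_const, intervalIntegral.integral_div, integral_pow]
  have : ((k + 1).factorial : ℝ) = (k + 1) * k.factorial := by
    push_cast [Nat.factorial_succ]; ring
  rw [this, zero_pow k.succ_ne_zero, sub_zero]
  field_simp

/-- Cameron–Martin shift for the standard Gaussian measure on `ℝ`. -/
theorem integral_mul_exp_gaussianReal (f : ℝ → ℝ) (v : ℝ) :
    ∫ z, f z * Real.exp (v * z - v ^ 2 / 2) ∂gaussianReal 0 1 =
      ∫ z, f (z + v) ∂gaussianReal 0 1 := by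
  rw [integral_gaussianReal_eq_integral_smul one_ne_zero,
    integral_gaussianReal_eq_integral_smul one_ne_zero,
    ← integral_sub_right_eq_self (fun z => gaussianPDFReal 0 1 z • f (z + v)) v]
  refine integral_congr_ae (Filter.Eventually.of_forall fun z => ?_)
  have : gaussianPDFReal 0 1 (z - v) =
      gaussianPDFReal 0 1 z * Real.exp (v * z - v ^ 2 / 2) := by
    simp only [gaussianPDFReal]
    rw [mul_assoc (√_)⁻¹, ← Real.exp_add]
    congr 2
    push_cast
    ring
  simp only [smul_eq_mul, sub_add_cancel, this]
  ring

theorem integrable_exp_mul_abs_gaussianReal (b : ℝ) :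
    Integrable (fun z => Real.exp (b * |z|)) (gaussianReal 0 1) :=
  integrable_exp_mul_abs (X := fun z => z) (integrable_exp_mul_gaussianReal b)
    (integrable_exp_mul_gaussianReal (-b))

/-- Gaussian smoothing of a function. -/
def gaussianSmooth (σ : ℝ) (f : ℝ → ℝ) (w : ℝ) : ℝ := ∫ z, f (w + σ * z) ∂gaussianReal 0 1

theorem stronglyMeasurable_gaussianSmooth (σ : ℝ) {f : ℝ → ℝ} (hf : Measurable f) :
    StronglyMeasurable (gaussianSmooth σ f) := by
  have : Measurable fun p : ℝ × ℝ => f (p.1 + σ * p.2) := by fun_prop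
  exact this.stronglyMeasurable.integral_prod_right'

theorem abs_gaussianSmooth_le (σ : ℝ) {f : ℝ → ℝ} (hf : ∀ x, |f x| ≤ 1) (w : ℝ) :
    |gaussianSmooth σ f w| ≤ 1 := by
  have h := norm_integral_le_of_norm_le_const (μ := gaussianReal 0 1)
    (Filter.Eventually.of_forall fun z : ℝ => (Real.norm_eq_abs _).trans_le (hf (w + σ * z)))
  rw [Real.norm_eq_abs, probReal_univ, mul_one] at h
  exact h

theorem intervalIntegrable_gaussianSmooth (σ : ℝ) {f : ℝ → ℝ} (hfm : Measurable f)
    (hf : ∀ x, |f x| ≤ 1) (x y : ℝ) :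
    IntervalIntegrable (gaussianSmooth σ f) volume x y :=
  (intervalIntegrable_const (c := (1 : ℝ))).mono_fun
    (stronglyMeasurable_gaussianSmooth σ hfm).aestronglyMeasurable
    (Filter.Eventually.of_forall fun w => by simpa using abs_gaussianSmooth_le σ hf w)

theorem integral_mul_hermitePrimitive {f : ℝ → ℝ} (hfm : Measurable f) (hf : ∀ x, |f x| ≤ 1)
    {σ : ℝ} (hσ : σ ≠ 0) (x u : ℝ) :
    ∫ z, f (x + σ * z) * hermitePrimitive u z ∂gaussianReal 0 1 =
      σ⁻¹ * ∫ w in x..x + σ * u, gaussianSmooth σ f w := by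
  have hint : Integrable
      (Function.uncurry fun v z => f (x + σ * z) * Real.exp (v * z - v ^ 2 / 2))
      ((volume.restrict (Set.uIoc 0 u)).prod (gaussianReal 0 1)) := by
    have : IsFiniteMeasure (volume.restrict (Set.uIoc 0 u)) :=
      ⟨by simp [Set.uIoc]⟩
    have hdom : Integrable (fun p : ℝ × ℝ => (1 : ℝ) * Real.exp (|u| * |p.2|))
        ((volume.restrict (Set.uIoc 0 u)).prod (gaussianReal 0 1)) :=
      (integrable_const (1 : ℝ)).mul_prod (integrable_exp_mul_abs_gaussianReal |u|)
    refine hdom.mono' ?_ ?_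
    · have : Measurable fun p : ℝ × ℝ =>
          f (x + σ * p.2) * Real.exp (p.1 * p.2 - p.1 ^ 2 / 2) := by fun_prop
      exact this.aestronglyMeasurable
    · have hae : ∀ᵐ p ∂((volume.restrict (Set.uIoc 0 u)).prod (gaussianReal 0 1)),
          p.1 ∈ Set.uIoc 0 u :=
        Measure.quasiMeasurePreserving_fst.ae (ae_restrict_mem measurableSet_uIoc)
      filter_upwards [hae] with p hp
      have hp' : |p.1| ≤ |u| := by
        rcases Set.mem_uIoc.1 hp with h | h
        · exact abs_le_abs_of_nonneg h.1.le h.2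
        · exact abs_le_abs_of_nonpos h.2 h.1.le
      simp only [Function.uncurry, norm_mul, Real.norm_eq_abs, abs_of_pos (Real.exp_pos _)]
      refine mul_le_mul (hf _) (Real.exp_le_exp.2 ?_) (Real.exp_pos _).le zero_le_one
      have h1 : p.1 * p.2 ≤ |u| * |p.2| := (le_abs_self _).trans
        (by rw [abs_mul]; exact mul_le_mul_of_nonneg_right hp' (abs_nonneg _))
      nlinarith [sq_nonneg p.1]
  have hswap := intervalIntegral_integral_swap hint
  have hL : ∀ z, f (x + σ * z) * hermitePrimitive u z =
      ∫ v in (0 : ℝ)..u, f (x + σ * z) * Real.exp (v * z - v ^ 2 / 2) := fun z => by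
    rw [intervalIntegral.integral_const_mul, hermitePrimitive]
  simp_rw [hL]
  rw [← hswap]
  have hR : ∀ v, ∫ z, f (x + σ * z) * Real.exp (v * z - v ^ 2 / 2) ∂gaussianReal 0 1 =
      gaussianSmooth σ f (x + σ * v) := fun v => by
    rw [integral_mul_exp_gaussianReal (fun z => f (x + σ * z)), gaussianSmooth]
    congr 1
    funext z
    congr 1
    ring
  simp_rw [hR]
  rw [intervalIntegral.integral_comp_add_mul (gaussianSmooth σ f) hσ]
  simp

/-- Two identically distributed random variables with integrable difference have a difference of
mean zero, even when they are not integrable themselves. -/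
theorem integral_sub_eq_zero_of_map_eq {Ω : Type*} [MeasurableSpace Ω] {P : Measure Ω}
    [IsProbabilityMeasure P] {U V : Ω → ℝ} (hU : Measurable U) (hV : Measurable V)
    (h : P.map U = P.map V) (hint : Integrable (fun ω => U ω - V ω) P) :
    ∫ ω, (U ω - V ω) ∂P = 0 := by
  let T : ℕ → ℝ → ℝ := fun n x => max (min x n) (-n)
  have hT : ∀ n, Measurable (T n) := fun n => by fun_prop
  have hTb : ∀ n x, |T n x| ≤ n := fun n x => by
    have : (0 : ℝ) ≤ n := n.cast_nonneg
    exact abs_le.2 ⟨le_max_right _ _, max_le (min_le_right _ _) (by linarith)⟩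
  have hTL : ∀ n x y, |T n x - T n y| ≤ |x - y| := fun n x y =>
    by
    refine (abs_max_sub_max_le_abs _ _ _).trans ((abs_min_sub_min_le_max _ _ _ _).trans ?_)
    simp
  have hTlim : ∀ x, Filter.Tendsto (fun n => T n x) Filter.atTop (𝓝 x) := fun x => by
    refine tendsto_const_nhds.congr' ?_
    obtain ⟨N, hN⟩ := exists_nat_ge |x|
    filter_upwards [Filter.eventually_ge_atTop N] with n hn
    have hn' : |x| ≤ n := hN.trans (by exact_mod_cast hn)
    simp only [T]
    rw [min_eq_left (abs_le.1 hn').2, max_eq_left (abs_le.1 hn').1]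
  have hTi : ∀ n {W : Ω → ℝ}, Measurable W → Integrable (fun ω => T n (W ω)) P :=
    fun n W hW => Integrable.of_bound ((hT n).comp hW).aestronglyMeasurable n
      (Filter.Eventually.of_forall fun ω => hTb n _)
  have hzero : ∀ n, ∫ ω, (T n (U ω) - T n (V ω)) ∂P = 0 := fun n => by
    rw [integral_sub (hTi n hU) (hTi n hV),
      ← integral_map hU.aemeasurable (hT n).aestronglyMeasurable, h,
      integral_map hV.aemeasurable (hT n).aestronglyMeasurable, sub_self]
  have hlim := tendsto_integral_of_dominated_convergence (μ := P)
    (F := fun n ω => T n (U ω) - T n (V ω)) (f := fun ω => U ω - V ω)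
    (fun ω => |U ω - V ω|)
    (fun n => ((hTi n hU).sub (hTi n hV)).aestronglyMeasurable) hint.abs
    (fun n => Filter.Eventually.of_forall fun ω => hTL n _ _)
    (Filter.Eventually.of_forall fun ω => (hTlim _).sub (hTlim _))
  simp_rw [hzero] at hlim
  exact tendsto_nhds_unique hlim tendsto_const_nhds

/-- If `Z` is independent of `(U, V)`, then conditioning a function of `(U, V)` on `U` does not
change its integral against functions of `(U, Z)`. -/
theorem integral_condExp_mul_of_indepFun {Ω : Type*} [MeasurableSpace Ω] {P : Measure Ω}
    [IsProbabilityMeasure P] {U V Z : Ω → ℝ} (hU : Measurable U) (hV : Measurable V)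
    (hZ : Measurable Z) (hind : IndepFun (fun ω => (U ω, V ω)) Z P)
    {g : ℝ × ℝ → ℝ} (hg : Measurable g) {C : ℝ} (hgC : ∀ᵐ ω ∂P, |g (U ω, V ω)| ≤ C)
    {ψ : ℝ × ℝ → ℝ} (hψ : Measurable ψ) {K : ℝ → ℝ} (hψK : ∀ x z, |ψ (x, z)| ≤ K z)
    (hK : Integrable (fun ω => K (Z ω)) P) :
    ∫ ω, (P[fun ω => g (U ω, V ω) | MeasurableSpace.comap U inferInstance]) ω *
        ψ (U ω, Z ω) ∂P = ∫ ω, g (U ω, V ω) * ψ (U ω, Z ω) ∂P := by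
  have hm : MeasurableSpace.comap U inferInstance ≤ ‹MeasurableSpace Ω› := hU.comap_le
  have hbd := ae_bdd_abs_condExp_of_ae_bdd_abs
    (m := MeasurableSpace.comap U inferInstance) hgC
  have hgm : Measurable fun ω => g (U ω, V ω) := hg.comp (hU.prodMk hV)
  have hgi : Integrable (fun ω => g (U ω, V ω)) P :=
    Integrable.of_bound hgm.aestronglyMeasurable C hgC
  have hpull : ∀ z, ∫ ω, (P[fun ω => g (U ω, V ω) |
      MeasurableSpace.comap U inferInstance]) ω * ψ (U ω, z) ∂P =
      ∫ ω, g (U ω, V ω) * ψ (U ω, z) ∂P := fun z => by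
    have hψz : Measurable fun x => ψ (x, z) := by fun_prop
    have hsm : StronglyMeasurable[MeasurableSpace.comap U inferInstance]
        fun ω => ψ (U ω, z) :=
      (hψz.comp (comap_measurable U)).stronglyMeasurable
    have hi : Integrable ((fun ω => g (U ω, V ω)) * fun ω => ψ (U ω, z)) P :=
      hgi.mul_bdd (hψz.comp hU).aestronglyMeasurable
        (Filter.Eventually.of_forall fun ω => hψK (U ω) z)
    exact (integral_congr_ae (condExp_mul_of_stronglyMeasurable_right hsm hi hgi)).symm.trans
      (integral_condExp hm)
  obtain ⟨h, hh, hcomp⟩ := (stronglyMeasurable_condExp (μ := P)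
    (m := MeasurableSpace.comap U inferInstance)
    (f := fun ω => g (U ω, V ω))).measurable.exists_eq_measurable_comp
  rw [hcomp] at hbd
  simp_rw [hcomp] at hpull ⊢
  simp only [Function.comp_apply] at hpull hbd ⊢
  have hmap := (indepFun_iff_map_prod_eq_prod_map_map (hU.prodMk hV).aemeasurable
    hZ.aemeasurable).1 hind
  have key : ∀ {k : ℝ × ℝ → ℝ}, Measurable k → (∀ᵐ ω ∂P, |k (U ω, V ω)| ≤ C) →
      ∫ ω, k (U ω, V ω) * ψ (U ω, Z ω) ∂P =
        ∫ z, ∫ ω, k (U ω, V ω) * ψ (U ω, z) ∂P ∂(P.map Z) := fun {k} hk hkC => by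
    have hG : Measurable fun q : (ℝ × ℝ) × ℝ => k q.1 * ψ (q.1.1, q.2) := by fun_prop
    have hmeas : Measurable fun ω => ((U ω, V ω), Z ω) := (hU.prodMk hV).prodMk hZ
    have hi : Integrable (fun ω => k (U ω, V ω) * ψ (U ω, Z ω)) P := by
      refine (hK.const_mul C).mono'
        ((hk.comp (hU.prodMk hV)).mul (hψ.comp (hU.prodMk hZ))).aestronglyMeasurable ?_
      filter_upwards [hkC] with ω hω
      rw [Real.norm_eq_abs, abs_mul]
      exact mul_le_mul hω (hψK _ _) (abs_nonneg _) ((abs_nonneg _).trans hω)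
    have hi' : Integrable (fun q : (ℝ × ℝ) × ℝ => k q.1 * ψ (q.1.1, q.2))
        ((P.map fun ω => (U ω, V ω)).prod (P.map Z)) := by
      rw [← hmap]
      exact (integrable_map_measure hG.aestronglyMeasurable hmeas.aemeasurable).2 hi
    have e1 := integral_map (μ := P) hmeas.aemeasurable hG.aestronglyMeasurable
    have := Measure.isProbabilityMeasure_map (μ := P) hZ.aemeasurable
    have := Measure.isProbabilityMeasure_map (μ := P) (hU.prodMk hV).aemeasurable
    rw [hmap, integral_prod_symm _ hi'] at e1
    rw [← e1]
    refine integral_congr_ae (Filter.Eventually.of_forall fun z => ?_)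
    have hGz : Measurable fun p : ℝ × ℝ => k p * ψ (p.1, z) := by fun_prop
    exact integral_map (hU.prodMk hV).aemeasurable hGz.aestronglyMeasurable
  rw [key hg hgC, key (k := fun p => h p.1) (by fun_prop) hbd]
  exact integral_congr_ae (Filter.Eventually.of_forall hpull)

theorem integral_mul_hermitePrimitive_eq_zero {Ω : Type*} [MeasurableSpace Ω] {P : Measure Ω}
    [IsProbabilityMeasure P] {U V Z : Ω → ℝ} (hU : Measurable U) (hV : Measurable V)
    (hZ : Measurable Z) (hUV : P.map U = P.map V) (hZlaw : P.map Z = gaussianReal 0 1)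
    (hind : IndepFun (fun ω => (U ω, V ω)) Z P) {B : ℝ} (hB : ∀ᵐ ω ∂P, |V ω - U ω| ≤ B)
    {a σ : ℝ} (ha : 0 ≤ a) (hσ : 0 < σ) {f : ℝ → ℝ} (hfm : Measurable f)
    (hf : ∀ x, |f x| ≤ 1) :
    ∫ ω, f (a * U ω + σ * Z ω) * hermitePrimitive (a / σ * (V ω - U ω)) (Z ω) ∂P = 0 := by
  have hmeas : Measurable fun ω => ((U ω, V ω), Z ω) := (hU.prodMk hV).prodMk hZ
  have hHP : Measurable fun q : (ℝ × ℝ) × ℝ =>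
      hermitePrimitive (a / σ * (q.1.2 - q.1.1)) q.2 :=
    continuous_hermitePrimitive.measurable.comp
      (by fun_prop : Measurable fun q : (ℝ × ℝ) × ℝ => (a / σ * (q.1.2 - q.1.1), q.2))
  have hG : Measurable fun q : (ℝ × ℝ) × ℝ =>
      f (a * q.1.1 + σ * q.2) * hermitePrimitive (a / σ * (q.1.2 - q.1.1)) q.2 :=
    (hfm.comp (by fun_prop)).mul hHP
  have hexp : Integrable (fun ω => Real.exp (a / σ * B * |Z ω|)) P := by
    have h := integrable_exp_mul_abs_gaussianReal (a / σ * B)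
    rw [← hZlaw] at h
    exact h.comp_measurable hZ
  have hi : Integrable (fun ω => f (a * U ω + σ * Z ω) *
      hermitePrimitive (a / σ * (V ω - U ω)) (Z ω)) P := by
    refine (hexp.const_mul (a / σ * B)).mono' (hG.comp hmeas).aestronglyMeasurable ?_
    filter_upwards [hB] with ω hω
    have hu : |a / σ * (V ω - U ω)| ≤ a / σ * B := by
      rw [abs_mul, abs_of_nonneg (by positivity : 0 ≤ a / σ)]
      gcongr
    rw [Real.norm_eq_abs, abs_mul, ← one_mul (a / σ * B * Real.exp _)]
    exact mul_le_mul (hf _) (abs_hermitePrimitive_le hu _) (abs_nonneg _) zero_le_one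
  have hmap := (indepFun_iff_map_prod_eq_prod_map_map (hU.prodMk hV).aemeasurable
    hZ.aemeasurable).1 hind
  have hi' := (integrable_map_measure hG.aestronglyMeasurable hmeas.aemeasurable).2 hi
  have e1 := integral_map (μ := P) hmeas.aemeasurable hG.aestronglyMeasurable
  have := Measure.isProbabilityMeasure_map (μ := P) (hU.prodMk hV).aemeasurable
  rw [hmap, hZlaw] at hi' e1
  rw [integral_prod _ hi'] at e1
  simp_rw [integral_mul_hermitePrimitive hfm hf hσ.ne'] at e1
  rw [← e1]
  let Φ : ℝ → ℝ := fun y => ∫ w in (0 : ℝ)..y, gaussianSmooth σ f w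
  have hΦ : Continuous Φ := intervalIntegral.continuous_primitive
    (intervalIntegrable_gaussianSmooth σ hfm hf) 0
  have hsub : ∀ x y, ∫ w in x..y, gaussianSmooth σ f w = Φ y - Φ x := fun x y =>
    (intervalIntegral.integral_interval_sub_left
      (intervalIntegrable_gaussianSmooth σ hfm hf _ _)
      (intervalIntegrable_gaussianSmooth σ hfm hf _ _)).symm
  have hΦL : ∀ x y, |Φ y - Φ x| ≤ |y - x| := fun x y => by
    rw [← hsub]
    simpa using intervalIntegral.norm_integral_le_of_norm_le_const (a := x) (b := y)
      (fun w _ => (Real.norm_eq_abs _).trans_le (abs_gaussianSmooth_le σ hf w))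
  have hend : ∀ p : ℝ × ℝ, a * p.1 + σ * (a / σ * (p.2 - p.1)) = a * p.2 := fun p => by
    field_simp
    ring
  simp_rw [hend, hsub]
  rw [integral_map (hU.prodMk hV).aemeasurable (Continuous.aestronglyMeasurable (by fun_prop)),
    integral_const_mul]
  have hmU : Measurable fun x => Φ (a * x) := (hΦ.comp (by fun_prop)).measurable
  refine mul_eq_zero_of_right _
    (integral_sub_eq_zero_of_map_eq (hmU.comp hV) (hmU.comp hU) ?_ ?_)
  · exact (Measure.map_map hmU hV).symm.trans
      ((congrArg _ hUV.symm).trans (Measure.map_map hmU hU))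
  · refine Integrable.of_bound ((hmU.comp hV).sub (hmU.comp hU)).aestronglyMeasurable (a * B) ?_
    filter_upwards [hB] with ω hω
    refine (hΦL _ _).trans ?_
    rw [← mul_sub, abs_mul, abs_of_nonneg ha]
    gcongr

/-- Summation of the Hermite series under the integral sign. -/
theorem hasSum_integral_hermite_series {Ω : Type*} [MeasurableSpace Ω] {μ : Measure Ω}
    {Z : Ω → ℝ} (hZ : Measurable Z) (hexp : ∀ r, Integrable (fun ω => Real.exp (r * |Z ω|)) μ)
    {m : ℕ → Ω → ℝ} (hm : ∀ k, AEStronglyMeasurable (m k) μ) {b : ℝ} (hb : 0 ≤ b)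
    (hmb : ∀ k, ∀ᵐ ω ∂μ, |m k ω| ≤ b ^ (k + 1)) :
    Integrable (fun ω => ∑' k : ℕ, m k ω / (k + 1).factorial * hermiteR k (Z ω)) μ ∧
    HasSum (fun k : ℕ => ∫ ω, m k ω / (k + 1).factorial * hermiteR k (Z ω) ∂μ)
      (∫ ω, ∑' k : ℕ, m k ω / (k + 1).factorial * hermiteR k (Z ω) ∂μ) := by
  set D : Ω → ℝ := fun ω => b * Real.exp ((2 * b + 1) * |Z ω| + (2 * b + 1) ^ 2 / 2) with hD
  have hDi : Integrable D μ := by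
    simp only [hD, Real.exp_add]
    exact ((hexp (2 * b + 1)).mul_const _).const_mul b
  have hmeas : ∀ k, AEStronglyMeasurable
      (fun ω => m k ω / (k + 1).factorial * hermiteR k (Z ω)) μ := fun k =>
    (by simpa only [div_eq_mul_inv] using (hm k).mul_const _ :
      AEStronglyMeasurable (fun ω => m k ω / (k + 1).factorial) μ).mul
      ((continuous_hermiteR k).measurable.comp hZ).aestronglyMeasurable
  have hbound : ∀ᵐ ω ∂μ, ∀ k : ℕ,
      ‖m k ω / (k + 1).factorial * hermiteR k (Z ω)‖ ≤ (1 / 2) ^ k * D ω := by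
    filter_upwards [ae_all_iff.2 hmb] with ω hω k
    exact abs_hermite_term_le hb k (Z ω) (hω k)
  have hsum : ∀ ω, HasSum (fun k : ℕ => (1 / 2 : ℝ) ^ k * D ω) (2 * D ω) := fun ω =>
    hasSum_geometric_two.mul_right _
  have hi2 : Integrable (fun ω => ∑' k : ℕ, (1 / 2 : ℝ) ^ k * D ω) μ := by
    simp_rw [(hsum _).tsum_eq]
    exact hDi.const_mul 2
  have hlim : ∀ᵐ ω ∂μ, HasSum (fun k : ℕ => m k ω / (k + 1).factorial * hermiteR k (Z ω))
      (∑' k : ℕ, m k ω / (k + 1).factorial * hermiteR k (Z ω)) := by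
    filter_upwards [hbound] with ω hω
    exact (Summable.of_norm_bounded (hsum ω).summable hω).hasSum
  refine ⟨?_, hasSum_integral_of_dominated_convergence (fun k ω => (1 / 2) ^ k * D ω) hmeas
    (ae_all_iff.1 hbound) (Filter.Eventually.of_forall fun ω => (hsum ω).summable) hi2 hlim⟩
  refine (hDi.const_mul 2).mono' ?_ ?_
  · refine aestronglyMeasurable_of_tendsto_ae Filter.atTop
      (f := fun n ω => ∑ k ∈ Finset.range n, m k ω / (k + 1).factorial * hermiteR k (Z ω))
      (fun n => Finset.aestronglyMeasurable_fun_sum _ fun k _ => hmeas k) ?_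
    filter_upwards [hlim] with ω hω
    exact hω.tendsto_sum_nat
  · filter_upwards [hbound] with ω hω
    exact tsum_of_norm_bounded (hsum ω) hω

/-- The coefficients of `τ` in terms of `a = exp (-t)` and `σ = √(1 - exp (-2 t))`. -/
theorem tau_coefficient {s t : ℝ} (ht : 0 < t) (k : ℕ) :
    Real.exp (-((k + 1 : ℕ) : ℝ) * t) / (s * (k + 1).factorial *
        (1 - Real.exp (-2 * t)) ^ ((((k + 1 : ℕ) : ℝ) - 1) / 2)) =
      Real.sqrt (1 - Real.exp (-2 * t)) / s *
        ((Real.exp (-t) / Real.sqrt (1 - Real.exp (-2 * t))) ^ (k + 1) /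
          (k + 1).factorial) := by
  have hv : 0 < 1 - Real.exp (-2 * t) := by
    rw [sub_pos, Real.exp_lt_one_iff]; linarith
  have h1 : Real.exp (-((k + 1 : ℕ) : ℝ) * t) = Real.exp (-t) ^ (k + 1) := by
    rw [← Real.exp_nat_mul]; ring_nf
  have h2 : (1 - Real.exp (-2 * t)) ^ ((((k + 1 : ℕ) : ℝ) - 1) / 2) =
      Real.sqrt (1 - Real.exp (-2 * t)) ^ k := by
    rw [Real.sqrt_eq_rpow, ← Real.rpow_natCast, ← Real.rpow_mul hv.le]
    congr 1
    push_cast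
    ring
  have hσ := (Real.sqrt_pos.2 hv).ne'
  rw [h1, h2]
  generalize Real.sqrt (1 - Real.exp (-2 * t)) = σ at hσ ⊢
  rw [div_pow, pow_succ σ]
  field_simp

theorem tau_dim_one
    {Ω : Type*} [MeasurableSpace Ω] (P : Measure Ω) [IsProbabilityMeasure P]
    (ν : Measure ℝ) (s t : ℝ) (hs : 0 < s) (ht : 0 < t)
    (X : ℝ → Ω → ℝ) (hXmeas : ∀ u, 0 ≤ u → Measurable (X u))
    (hlaw0 : P.map (X 0) = ν) (hlawt : P.map (X t) = ν)
    (hbdd : ∃ B : ℝ, ∀ᵐ ω ∂P, |X t ω - X 0 ω| ≤ B)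
    (Z : Ω → ℝ) (hZ : Measurable Z) (hZlaw : P.map Z = gaussianReal 0 1)
    (hindep : Indep (MeasurableSpace.comap Z inferInstance)
      (⨆ u : ℝ, MeasurableSpace.comap (X u) inferInstance) P)
    (F : Ω → ℝ)
    (hF : F = fun ω => Real.exp (-t) * X 0 ω + Real.sqrt (1 - Real.exp (-2 * t)) * Z ω)
    (τ : Ω → ℝ)
    (hτ : τ = fun ω => ∑' k : ℕ, if 1 ≤ k then
        (Real.exp (-(k : ℝ) * t) /
            (s * k.factorial * (1 - Real.exp (-2 * t)) ^ (((k : ℝ) - 1) / 2))) *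
          ((P[fun ω' => (X t ω' - X 0 ω') ^ k |
            MeasurableSpace.comap (X 0) inferInstance]) ω) *
          hermiteR (k - 1) (Z ω)
      else 0) :
    P[τ | MeasurableSpace.comap F inferInstance] =ᵐ[P] 0 := by
  obtain ⟨B, hB⟩ := hbdd
  have hB0 : 0 ≤ B := by
    obtain ⟨ω, hω⟩ := hB.exists
    exact (abs_nonneg _).trans hω
  have hU := hXmeas 0 le_rfl
  have hV := hXmeas t ht.le
  have hind : IndepFun (fun ω => (X 0 ω, X t ω)) Z P := by
    refine (IndepFun_iff_Indep _ _ _).2 (indep_of_indep_of_le_left hindep.symm ?_)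
    refine Measurable.comap_le ?_
    exact ((comap_measurable (X 0)).mono (le_iSup (fun u => MeasurableSpace.comap (X u)
      inferInstance) 0) le_rfl).prodMk ((comap_measurable (X t)).mono
        (le_iSup (fun u => MeasurableSpace.comap (X u) inferInstance) t) le_rfl)
  have hv : 0 < 1 - Real.exp (-2 * t) := by
    rw [sub_pos, Real.exp_lt_one_iff]; linarith
  set σ := Real.sqrt (1 - Real.exp (-2 * t)) with hσdef
  have hσ : 0 < σ := Real.sqrt_pos.2 hv
  set c := Real.exp (-t) / σ with hcdef
  have hc : 0 < c := div_pos (Real.exp_pos _) hσ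
  set M : ℕ → Ω → ℝ := fun k => P[fun ω' => (X t ω' - X 0 ω') ^ (k + 1) |
    MeasurableSpace.comap (X 0) inferInstance] with hM
  have hτ' : τ = fun ω => σ / s *
      ∑' k : ℕ, c ^ (k + 1) * M k ω / (k + 1).factorial * hermiteR k (Z ω) := by
    rw [hτ]
    funext ω
    rw [← Nat.succ_injective.tsum_eq]
    · rw [← tsum_mul_left]
      refine tsum_congr fun k => ?_
      rw [if_pos (Nat.succ_le_succ k.zero_le), Nat.succ_eq_add_one, tau_coefficient ht,
        Nat.add_sub_cancel]
      simp only [hM, hcdef, hσdef]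
      ring
    · intro k hk
      rcases k with _ | k
      · simp at hk
      · exact ⟨k, rfl⟩
  have hpow : ∀ k : ℕ, ∀ᵐ ω ∂P, |(X t ω - X 0 ω) ^ (k + 1)| ≤ B ^ (k + 1) := fun k => by
    filter_upwards [hB] with ω hω
    rw [abs_pow]
    gcongr
  have hMb : ∀ k : ℕ, ∀ᵐ ω ∂P, |c ^ (k + 1) * M k ω| ≤ (c * B) ^ (k + 1) := fun k => by
    filter_upwards [ae_bdd_abs_condExp_of_ae_bdd_abs
      (m := MeasurableSpace.comap (X 0) inferInstance) (hpow k)] with ω hω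
    rw [abs_mul, mul_pow, abs_of_pos (pow_pos hc _)]
    gcongr
  have hDb : ∀ k : ℕ, ∀ᵐ ω ∂P,
      |(c * (X t ω - X 0 ω)) ^ (k + 1)| ≤ (c * B) ^ (k + 1) := fun k => by
    filter_upwards [hpow k] with ω hω
    rw [mul_pow, abs_mul, mul_pow, abs_of_pos (pow_pos hc _)]
    gcongr
  have hexp : ∀ r, Integrable (fun ω => Real.exp (r * |Z ω|)) P := fun r => by
    have h := integrable_exp_mul_abs_gaussianReal r
    rw [← hZlaw] at h
    exact h.comp_measurable hZ
  have hMm : ∀ k, AEStronglyMeasurable (fun ω => c ^ (k + 1) * M k ω) P := fun k =>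
    (integrable_condExp.aestronglyMeasurable).const_mul _
  have hDm : ∀ k, AEStronglyMeasurable (fun ω => (c * (X t ω - X 0 ω)) ^ (k + 1)) P := fun k =>
    (((hV.sub hU).const_mul c).pow_const _).aestronglyMeasurable
  have hcB : 0 ≤ c * B := by positivity
  have hFm : Measurable F := by
    rw [hF]; fun_prop
  have hτi : Integrable τ P := by
    rw [hτ']
    exact (hasSum_integral_hermite_series hZ hexp hMm hcB hMb).1.const_mul _
  refine (ae_eq_condExp_of_forall_setIntegral_eq hFm.comap_le hτi
    (fun _ _ _ => integrableOn_zero) ?_ aestronglyMeasurable_zero).symm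
  rintro _ ⟨A, hA, rfl⟩ -
  have hS : MeasurableSet (F ⁻¹' A) := hFm hA
  have hterm : ∀ k : ℕ,
      ∫ ω in F ⁻¹' A, c ^ (k + 1) * M k ω / (k + 1).factorial * hermiteR k (Z ω) ∂P =
      ∫ ω in F ⁻¹' A,
        (c * (X t ω - X 0 ω)) ^ (k + 1) / (k + 1).factorial * hermiteR k (Z ω) ∂P := by
    intro k
    have h := integral_condExp_mul_of_indepFun hU hV hZ hind
      (g := fun p => (p.2 - p.1) ^ (k + 1)) (by fun_prop) (hpow k)
      (ψ := fun q => A.indicator 1 (Real.exp (-t) * q.1 + σ * q.2) * hermiteR k q.2)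
      (K := fun z => |hermiteR k z|)
      (((measurable_one.indicator hA).comp (by fun_prop)).mul
        ((continuous_hermiteR k).measurable.comp measurable_snd))
      (fun x z => by
        rw [abs_mul]
        refine mul_le_of_le_one_left (abs_nonneg _) ?_
        simp only [Set.indicator_apply]
        split_ifs <;> simp)
      ?_
    · rw [← integral_indicator hS, ← integral_indicator hS]
      have h' := congrArg (fun y => c ^ (k + 1) / (k + 1).factorial * y) h
      simp only [← integral_const_mul] at h'
      convert h' using 1 <;>
      · refine integral_congr_ae (Filter.Eventually.of_forall fun ω => ?_)
        have hω : F ω = Real.exp (-t) * X 0 ω + σ * Z ω := by rw [hF]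
        simp only [Set.indicator_apply, Set.mem_preimage, ← hω, hM]
        split_ifs
        · simp only [Pi.one_apply, mul_pow]; ring
        · simp
    · refine ((hexp 1).const_mul (k.factorial / 1 ^ k * Real.exp (1 ^ 2 / 2))).mono'
        ((continuous_hermiteR k).measurable.comp hZ).abs.aestronglyMeasurable
        (Filter.Eventually.of_forall fun ω => ?_)
      rw [Real.norm_eq_abs, abs_abs]
      refine (abs_hermiteR_le k (Z ω) one_pos).trans_eq ?_
      rw [Real.exp_add]
      ring
  have hr : ∀ {p : Ω → Prop}, (∀ᵐ ω ∂P, p ω) → ∀ᵐ ω ∂P.restrict (F ⁻¹' A), p ω :=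
    fun h => ae_restrict_of_ae h
  have hs1 := (hasSum_integral_hermite_series hZ (fun r => (hexp r).restrict (s := F ⁻¹' A))
    (fun k => (hMm k).restrict) hcB (fun k => hr (hMb k))).2
  have hs2 := (hasSum_integral_hermite_series hZ (fun r => (hexp r).restrict (s := F ⁻¹' A))
    (fun k => (hDm k).restrict) hcB (fun k => hr (hDb k))).2
  simp_rw [hterm] at hs1
  have hzero := integral_mul_hermitePrimitive_eq_zero hU hV hZ (hlaw0.trans hlawt.symm) hZlaw
    hind hB (Real.exp_pos (-t)).le hσ (f := A.indicator 1) (measurable_one.indicator hA)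
    (fun x => by
      simp only [Set.indicator_apply]
      split_ifs <;> simp)
  rw [hτ', integral_const_mul, hs1.unique hs2]
  simp_rw [(hasSum_hermitePrimitive _ _).tsum_eq]
  refine (integral_zero Ω ℝ).trans (Eq.symm ?_)
  rw [← integral_indicator hS]
  refine mul_eq_zero_of_right _ (Eq.trans ?_ hzero)
  refine integral_congr_ae (Filter.Eventually.of_forall fun ω => ?_)
  have hω : F ω = Real.exp (-t) * X 0 ω + σ * Z ω := by rw [hF]
  simp only [Set.indicator_apply, Set.mem_preimage, ← hω]
  split_ifs
  · simp only [Pi.one_apply, one_mul]; rfl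
  · simp

end
end

section
/- Let t > 0 and let g : ℝ^d → ℝ^d be a bounded measurable vector field, with P_t acting on g componentwise. Then for every x ∈ ℝ^d, Σ_α ((e^{2t} − 1)^{|α|}/α!) ‖∂^α (P_t g)(x)‖² = P_t(‖g‖²)(x), where the sum runs over all multi-indices α ∈ ℕ^d (including α = 0). -/
open MeasureTheory ProbabilityTheory Real
open scoped ENNReal NNReal BigOperators Topology Classical

noncomputable section

/-- The `n`-th Hermite function `Heₙ(y) ρ(y)`, with `ρ` the standard Gaussian density on `ℝ`. -/
def hermiteGaussian (n : ℕ) (y : ℝ) : ℝ := hermiteR n y * gaussianPDFReal 0 1 y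

lemma gaussianPDFReal_zero_one (y : ℝ) :
    gaussianPDFReal 0 1 y = (√(2 * π))⁻¹ * Real.exp (-(y ^ 2 / 2)) := by
  simp [gaussianPDFReal, neg_div]

lemma hermiteR_eq_eval (n : ℕ) (y : ℝ) :
    hermiteR n y = ((Polynomial.hermite n).map (algebraMap ℤ ℝ)).eval y := by
  rw [hermiteR, Polynomial.aeval_def, Polynomial.eval₂_eq_eval_map]

lemma hermiteGaussian_zero (y : ℝ) : hermiteGaussian 0 y = gaussianPDFReal 0 1 y := by
  simp [hermiteGaussian, hermiteR]

lemma hasDerivAt_hermiteGaussian (n : ℕ) (y : ℝ) :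
    HasDerivAt (hermiteGaussian n) (-hermiteGaussian (n + 1) y) y := by
  have h1 : HasDerivAt (hermiteR n)
      (Polynomial.aeval y (Polynomial.derivative (Polynomial.hermite n))) y :=
    Polynomial.hasDerivAt_aeval _ y
  have h2 : HasDerivAt (gaussianPDFReal 0 1) (-y * gaussianPDFReal 0 1 y) y := by
    have h3 : HasDerivAt (fun y : ℝ => (√(2 * π))⁻¹ * Real.exp (-(y ^ 2 / 2)))
        ((√(2 * π))⁻¹ * (Real.exp (-(y ^ 2 / 2)) * (-y))) y := by
      refine (HasDerivAt.exp ?_).const_mul _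
      have := ((hasDerivAt_pow 2 y).div_const 2).neg
      refine this.congr_deriv ?_
      simp
    rw [funext gaussianPDFReal_zero_one]
    convert h3 using 1
    ring
  refine (h1.mul h2).congr_deriv ?_
  simp only [hermiteGaussian, hermiteR, Polynomial.hermite_succ, map_sub, map_mul,
    Polynomial.aeval_X]
  ring

lemma continuous_hermiteGaussian (n : ℕ) : Continuous (hermiteGaussian n) :=
  continuous_iff_continuousAt.2 fun y => (hasDerivAt_hermiteGaussian n y).continuousAt

lemma exists_abs_eval_le_exp_abs (p : Polynomial ℝ) :
    ∃ C, 0 ≤ C ∧ ∀ y : ℝ, |p.eval y| ≤ C * Real.exp |y| := by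
  induction p using Polynomial.induction_on' with
  | add p q hp hq =>
    obtain ⟨C, hC, h⟩ := hp
    obtain ⟨D, hD, h'⟩ := hq
    refine ⟨C + D, by positivity, fun y => ?_⟩
    rw [Polynomial.eval_add, add_mul]
    exact (abs_add_le _ _).trans (add_le_add (h y) (h' y))
  | monomial n a =>
    refine ⟨|a| * n.factorial, by positivity, fun y => ?_⟩
    have h := Real.pow_div_factorial_le_exp |y| (abs_nonneg y) n
    rw [div_le_iff₀ (by positivity)] at h
    rw [Polynomial.eval_monomial, abs_mul, abs_pow, mul_assoc]
    gcongr
    linarith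

lemma exists_abs_hermiteGaussian_le (n : ℕ) (A : ℝ) :
    ∃ C, 0 ≤ C ∧ ∀ y : ℝ, |hermiteGaussian n y| ≤ C * Real.exp (-(A * |y|)) := by
  obtain ⟨C, hC, h⟩ := exists_abs_eval_le_exp_abs ((Polynomial.hermite n).map (algebraMap ℤ ℝ))
  refine ⟨C * (√(2 * π))⁻¹ * Real.exp ((A + 1) ^ 2 / 2), by positivity, fun y => ?_⟩
  have hexp : Real.exp |y| * Real.exp (-(y ^ 2 / 2)) ≤
      Real.exp ((A + 1) ^ 2 / 2) * Real.exp (-(A * |y|)) := by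
    rw [← Real.exp_add, ← Real.exp_add, Real.exp_le_exp, ← sq_abs y]
    nlinarith [sq_nonneg (|y| - (A + 1))]
  rw [hermiteGaussian, abs_mul, hermiteR_eq_eval, gaussianPDFReal_zero_one,
    abs_of_nonneg (by positivity : 0 ≤ (√(2 * π))⁻¹ * Real.exp (-(y ^ 2 / 2)))]
  calc _ ≤ C * Real.exp |y| * ((√(2 * π))⁻¹ * Real.exp (-(y ^ 2 / 2))) := by gcongr; exact h y
    _ = C * (√(2 * π))⁻¹ * (Real.exp |y| * Real.exp (-(y ^ 2 / 2))) := by ring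
    _ ≤ C * (√(2 * π))⁻¹ * (Real.exp ((A + 1) ^ 2 / 2) * Real.exp (-(A * |y|))) := by gcongr
    _ = _ := by ring

lemma integrable_exp_neg_abs : Integrable fun y : ℝ => Real.exp (-|y|) := by
  refine (integrable_inv_one_add_sq.const_mul 2).mono' (by fun_prop) (.of_forall fun y => ?_)
  rw [Real.norm_of_nonneg (by positivity), Real.exp_neg, inv_le_comm₀ (by positivity)
    (by positivity), mul_inv, inv_inv]
  have := Real.quadratic_le_exp_of_nonneg (abs_nonneg y)
  rw [sq_abs] at this
  linarith [abs_nonneg y]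

lemma integrable_hermiteGaussian_mul (n : ℕ) {u : ℝ → ℝ} (hu : AEStronglyMeasurable u)
    {C A : ℝ} (hb : ∀ y, |u y| ≤ C * Real.exp (A * |y|)) :
    Integrable fun y => hermiteGaussian n y * u y := by
  obtain ⟨D, hD, h⟩ := exists_abs_hermiteGaussian_le n (A + 1)
  refine (integrable_exp_neg_abs.const_mul (D * C)).mono'
    ((continuous_hermiteGaussian n).aestronglyMeasurable.mul hu) (.of_forall fun y => ?_)
  rw [Real.norm_eq_abs, abs_mul]
  calc _ ≤ (D * Real.exp (-((A + 1) * |y|))) * (C * Real.exp (A * |y|)) := by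
        gcongr
        exacts [h y, hb y]
    _ = D * C * (Real.exp (-((A + 1) * |y|)) * Real.exp (A * |y|)) := by ring
    _ = _ := by rw [← Real.exp_add]; ring_nf

lemma integral_hermiteGaussian_succ_mul (n : ℕ) {u u' : ℝ → ℝ}
    (hu : ∀ y, HasDerivAt u (u' y) y) {C A C' A' : ℝ}
    (hb : ∀ y, |u y| ≤ C * Real.exp (A * |y|)) (hb' : ∀ y, |u' y| ≤ C' * Real.exp (A' * |y|)) :
    ∫ y, hermiteGaussian (n + 1) y * u y = ∫ y, hermiteGaussian n y * u' y := by
  have hum : AEStronglyMeasurable u :=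
    (continuous_iff_continuousAt.2 fun y => (hu y).continuousAt).aestronglyMeasurable
  have hum' : AEStronglyMeasurable u' := by
    rw [← funext fun y => (hu y).deriv]
    exact (measurable_deriv u).aestronglyMeasurable
  have h := integral_mul_deriv_eq_deriv_mul_of_integrable (u := hermiteGaussian n) (v := u)
    (fun y _ => hasDerivAt_hermiteGaussian n y) (fun y _ => hu y)
    (integrable_hermiteGaussian_mul n hum' hb')
    (by
      have := (integrable_hermiteGaussian_mul (n + 1) hum hb).neg
      convert this using 1
      ext y
      simp)
    (integrable_hermiteGaussian_mul n hum hb)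
  rw [h, ← integral_neg]
  simp

lemma integral_hermiteGaussian_mul_exp (n : ℕ) (h : ℝ) :
    ∫ y, hermiteGaussian n y * Real.exp (h * y) = h ^ n * Real.exp (h ^ 2 / 2) := by
  have hb (y : ℝ) : Real.exp (h * y) ≤ Real.exp (|h| * |y|) := by
    rw [Real.exp_le_exp, ← abs_mul]
    exact le_abs_self _
  induction n with
  | zero =>
    simp_rw [hermiteGaussian_zero]
    have h1 := integral_gaussianReal_eq_integral_smul (μ := 0) (v := 1)
      (f := fun y => Real.exp (h * y)) one_ne_zero
    have h2 := mgf_gaussianReal (p := gaussianReal 0 1) (X := id) (μ := 0) (v := 1) (by simp) h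
    simp only [smul_eq_mul] at h1
    rw [← h1]
    simpa [mgf] using h2
  | succ n ih =>
    rw [integral_hermiteGaussian_succ_mul n (u := fun y => Real.exp (h * y))
      (u' := fun y => Real.exp (h * y) * h) (C := 1) (A := |h|) (C' := |h|) (A' := |h|)
      (fun y => by simpa using ((hasDerivAt_id y).const_mul h).exp)
      (fun y => by simpa using hb y)
      (fun y => by
        rw [abs_mul, Real.abs_exp, mul_comm]
        exact mul_le_mul_of_nonneg_left (hb y) (abs_nonneg h))]
    simp_rw [← mul_assoc]
    rw [integral_mul_const, ih]
    ring

lemma integral_hermiteGaussian_mul_eval (n : ℕ) (p : Polynomial ℝ) :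
    ∫ y, hermiteGaussian n y * p.eval y =
      ∫ y, gaussianPDFReal 0 1 y * ((Polynomial.derivative^[n]) p).eval y := by
  induction n generalizing p with
  | zero => simp [hermiteGaussian_zero]
  | succ n ih =>
    obtain ⟨C, -, hC⟩ := exists_abs_eval_le_exp_abs p
    obtain ⟨C', -, hC'⟩ := exists_abs_eval_le_exp_abs (Polynomial.derivative p)
    rw [integral_hermiteGaussian_succ_mul n (fun y => p.hasDerivAt y) (C := C) (A := 1)
      (C' := C') (A' := 1) (by simpa using hC) (by simpa using hC'), ih]
    rfl

lemma integral_hermiteGaussian_mul_hermiteR (m n : ℕ) :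
    ∫ y, hermiteGaussian m y * hermiteR n y = if m = n then (n.factorial : ℝ) else 0 := by
  wlog hmn : n ≤ m generalizing m n
  · rw [funext fun y => show hermiteGaussian m y * hermiteR n y =
      hermiteGaussian n y * hermiteR m y by simp only [hermiteGaussian]; ring,
      this n m (by omega), if_neg (by omega), if_neg (by omega)]
  have hdeg : ((Polynomial.hermite n).map (algebraMap ℤ ℝ)).natDegree = n := by
    rw [(Polynomial.hermite_monic n).natDegree_map, Polynomial.natDegree_hermite]
  simp_rw [hermiteR_eq_eval, integral_hermiteGaussian_mul_eval]
  split_ifs with h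
  · subst h
    have hC := Polynomial.eq_C_of_natDegree_le_zero
      ((Polynomial.natDegree_iterate_derivative
        ((Polynomial.hermite m).map (algebraMap ℤ ℝ)) m).trans (by omega))
    have hlead : ((Polynomial.hermite m).map (algebraMap ℤ ℝ)).coeff m = 1 := by
      simp
    rw [hC, Polynomial.coeff_iterate_derivative, zero_add, hlead]
    simp [integral_mul_const, Nat.descFactorial_self, integral_gaussianPDFReal_eq_one]
  · rw [Polynomial.iterate_derivative_eq_zero (by omega)]
    simp

lemma gaussian_density_eq_prod {d : ℕ} (x : Euc d) :
    (2 * π) ^ (-(d : ℝ) / 2) * Real.exp (-‖x‖ ^ 2 / 2) = ∏ i, gaussianPDFReal 0 1 (x i) := by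
  simp_rw [gaussianPDFReal_zero_one, Finset.prod_mul_distrib, ← Real.exp_sum, Finset.prod_const,
    Finset.card_univ, Fintype.card_fin, EuclideanSpace.norm_sq_eq, Real.norm_eq_abs, sq_abs,
    Finset.sum_neg_distrib, ← Finset.sum_div, neg_div]
  congr 1
  rw [Real.sqrt_eq_rpow, ← Real.rpow_neg (by positivity), ← Real.rpow_natCast,
    ← Real.rpow_mul (by positivity)]
  congr 1
  ring

lemma stdGaussian_eq_withDensity_prod (d : ℕ) :
    _root_.stdGaussian d =
      volume.withDensity fun x => ENNReal.ofReal (∏ i, gaussianPDFReal 0 1 (x i)) := by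
  simp_rw [_root_.stdGaussian, gaussian_density_eq_prod]

lemma measurable_prod_gaussianPDFReal (d : ℕ) :
    Measurable fun x : Euc d => ∏ i, gaussianPDFReal 0 1 (x i) :=
  Finset.measurable_fun_prod _ fun i _ => (measurable_gaussianPDFReal 0 1).comp (by fun_prop)

lemma integral_stdGaussian {d : ℕ} (f : Euc d → ℝ) :
    ∫ y, f y ∂(_root_.stdGaussian d) = ∫ y, (∏ i, gaussianPDFReal 0 1 (y i)) * f y := by
  rw [stdGaussian_eq_withDensity_prod, integral_withDensity_eq_integral_toReal_smul
    (measurable_prod_gaussianPDFReal d).ennreal_ofReal (by simp)]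
  simp_rw [ENNReal.toReal_ofReal (Finset.prod_nonneg fun i _ => gaussianPDFReal_nonneg 0 1 _),
    smul_eq_mul]

lemma integrable_stdGaussian_iff {d : ℕ} {f : Euc d → ℝ} :
    Integrable f (_root_.stdGaussian d) ↔
      Integrable fun y => (∏ i, gaussianPDFReal 0 1 (y i)) * f y := by
  rw [stdGaussian_eq_withDensity_prod, integrable_withDensity_iff_integrable_smul'
    (measurable_prod_gaussianPDFReal d).ennreal_ofReal (by simp)]
  simp_rw [ENNReal.toReal_ofReal (Finset.prod_nonneg fun i _ => gaussianPDFReal_nonneg 0 1 _),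
    smul_eq_mul]

lemma EuclideanSpace.integral_prod_eq_prod_integral {d : ℕ} (q : Fin d → ℝ → ℝ) :
    ∫ y : Euc d, ∏ i, q i (y i) = ∏ i, ∫ y, q i y := by
  rw [← integral_fintype_prod_volume_eq_prod, ← (PiLp.volume_preserving_toLp (Fin d)).integral_comp
    (MeasurableEquiv.toLp 2 (Fin d → ℝ)).measurableEmbedding]

lemma EuclideanSpace.integrable_prod {d : ℕ} {q : Fin d → ℝ → ℝ} (hq : ∀ i, Integrable (q i)) :
    Integrable fun y : Euc d => ∏ i, q i (y i) :=
  ((PiLp.volume_preserving_toLp (Fin d)).integrable_comp_emb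
    (MeasurableEquiv.toLp 2 (Fin d → ℝ)).measurableEmbedding).1 (Integrable.fintype_prod hq)

lemma integral_stdGaussian_prod {d : ℕ} (q : Fin d → ℝ → ℝ) :
    ∫ y, ∏ i, q i (y i) ∂(_root_.stdGaussian d) = ∏ i, ∫ y, gaussianPDFReal 0 1 y * q i y := by
  rw [integral_stdGaussian, ← EuclideanSpace.integral_prod_eq_prod_integral]
  simp_rw [Finset.prod_mul_distrib]

lemma integrable_stdGaussian_prod {d : ℕ} {q : Fin d → ℝ → ℝ}
    (hq : ∀ i, Integrable fun y => gaussianPDFReal 0 1 y * q i y) :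
    Integrable (fun y => ∏ i, q i (y i)) (_root_.stdGaussian d) := by
  rw [integrable_stdGaussian_iff]
  simpa only [Finset.prod_mul_distrib] using EuclideanSpace.integrable_prod hq

instance isProbabilityMeasure_stdGaussian (d : ℕ) :
    IsProbabilityMeasure (_root_.stdGaussian d) := by
  have h1 : Integrable (fun _ => (1 : ℝ)) (_root_.stdGaussian d) := by
    simpa using integrable_stdGaussian_prod (d := d) (q := fun _ _ => 1)
      (by simpa using fun _ => integrable_gaussianPDFReal 0 1)
  have h2 := integral_stdGaussian_prod (d := d) (fun _ _ => 1)
  have : IsFiniteMeasure (_root_.stdGaussian d) := (integrable_const_iff_isFiniteMeasure one_ne_zero).1 h1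
  refine ⟨?_⟩
  simp only [Finset.prod_const_one, mul_one, integral_const, smul_eq_mul,
    integral_gaussianPDFReal_eq_one 0 one_ne_zero] at h2
  rw [measureReal_def] at h2
  exact (ENNReal.toReal_eq_one_iff _).1 h2

lemma measurable_hermiteM {d : ℕ} (α : Fin d → ℕ) : Measurable (hermiteM α) := by
  unfold hermiteM hermiteR
  refine Finset.measurable_fun_prod _ fun i _ => ?_
  exact (Polynomial.continuous_aeval _).measurable.comp (by fun_prop)

lemma integral_hermiteM_mul_hermiteM {d : ℕ} (α β : Fin d → ℕ) :
    ∫ y, hermiteM α y * hermiteM β y ∂(_root_.stdGaussian d) =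
      if α = β then (mfact α : ℝ) else 0 := by
  simp_rw [hermiteM, ← Finset.prod_mul_distrib]
  rw [integral_stdGaussian_prod fun i y => hermiteR (α i) y * hermiteR (β i) y]
  have h (i : Fin d) : ∫ y, gaussianPDFReal 0 1 y * (hermiteR (α i) y * hermiteR (β i) y) =
      if α i = β i then ((β i).factorial : ℝ) else 0 := by
    rw [← integral_hermiteGaussian_mul_hermiteR]
    congr with y
    simp only [hermiteGaussian]
    ring
  simp_rw [h]
  split_ifs with hαβ
  · simp [hαβ, mfact]
  · obtain ⟨i, hi⟩ := Function.ne_iff.1 hαβ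
    exact Finset.prod_eq_zero (Finset.mem_univ i) (if_neg hi)

lemma memLp_hermiteM {d : ℕ} (α : Fin d → ℕ) :
    MemLp (hermiteM α) 2 (_root_.stdGaussian d) := by
  rw [memLp_two_iff_integrable_sq (measurable_hermiteM α).aestronglyMeasurable]
  simp_rw [hermiteM, ← Finset.prod_pow]
  refine integrable_stdGaussian_prod (q := fun i y => hermiteR (α i) y ^ 2) fun i => ?_
  obtain ⟨C, hC, h⟩ := exists_abs_eval_le_exp_abs
    ((Polynomial.hermite (α i)).map (algebraMap ℤ ℝ))
  have := integrable_hermiteGaussian_mul (α i) (u := hermiteR (α i)) (C := C) (A := 1)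
    (Polynomial.continuous_aeval _).aestronglyMeasurable (by simpa [hermiteR_eq_eval] using h)
  refine this.congr (.of_forall fun y => ?_)
  simp only [hermiteGaussian]
  ring

lemma integral_hermiteM_mul_exp {d : ℕ} (α : Fin d → ℕ) (h : Euc d) :
    ∫ y, hermiteM α y * Real.exp (∑ i, h i * y i) ∂(_root_.stdGaussian d) =
      ∏ i, (h i ^ α i * Real.exp (h i ^ 2 / 2)) := by
  simp_rw [hermiteM, Real.exp_sum, ← Finset.prod_mul_distrib]
  rw [integral_stdGaussian_prod fun i y => hermiteR (α i) y * Real.exp (h i * y)]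
  congr with i
  rw [← integral_hermiteGaussian_mul_exp]
  congr with y
  simp only [hermiteGaussian]
  ring

lemma integral_exp_sq {d : ℕ} (h : Euc d) :
    ∫ y, Real.exp (∑ i, h i * y i) ^ 2 ∂(_root_.stdGaussian d) =
      ∏ i, (Real.exp (h i ^ 2) * Real.exp (h i ^ 2)) := by
  simp_rw [Real.exp_sum, ← Finset.prod_pow]
  rw [integral_stdGaussian_prod fun i y => Real.exp (h i * y) ^ 2]
  congr with i
  have := integral_hermiteGaussian_mul_exp 0 (2 * h i)
  simp_rw [hermiteGaussian_zero] at this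
  simp_rw [← Real.exp_nat_mul]
  push_cast
  simp_rw [← mul_assoc]
  rw [this, ← Real.exp_add, pow_zero, one_mul]
  ring_nf

lemma memLp_exp {d : ℕ} (h : Euc d) :
    MemLp (fun y => Real.exp (∑ i, h i * y i)) 2 (_root_.stdGaussian d) := by
  rw [memLp_two_iff_integrable_sq (by fun_prop)]
  refine .of_integral_ne_zero ?_
  rw [integral_exp_sq]
  positivity
lemma ContinuousLinearMap.mul_apply_eq_sum {d : ℕ} (L : Euc d →L[ℝ] ℝ) (s : ℝ) (y : Euc d) :
    s * L y = ∑ i, (s * L (EuclideanSpace.single i 1)) * y i := by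
  have hy : y = ∑ i, y i • EuclideanSpace.single i (1 : ℝ) := by
    simpa using ((EuclideanSpace.basisFun (Fin d) ℝ).sum_repr y).symm
  conv_lhs => rw [hy]
  rw [map_sum, Finset.mul_sum]
  refine Finset.sum_congr rfl fun i _ => ?_
  rw [map_smul, smul_eq_mul]
  ring

/-- Finite measures on `ℝ^d` with the same Laplace transform, finite everywhere, are equal. -/
lemma MeasureTheory.Measure.ext_of_integral_exp {d : ℕ} {μ ν : Measure (Euc d)}
    [IsFiniteMeasure μ] [IsFiniteMeasure ν]
    (hμ : ∀ h : Euc d, Integrable (fun y => Real.exp (∑ i, h i * y i)) μ)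
    (heq : ∀ h : Euc d, ∫ y, Real.exp (∑ i, h i * y i) ∂μ = ∫ y, Real.exp (∑ i, h i * y i) ∂ν) :
    μ = ν := by
  refine Measure.ext_of_charFunDual (funext fun L => ?_)
  have hL (s : ℝ) : (fun y => Real.exp (s * L y)) = fun y => Real.exp
      (∑ i, (WithLp.toLp 2 fun i => s * L (EuclideanSpace.single i 1) : Euc d) i * y i) :=
    funext fun y => congrArg Real.exp (L.mul_apply_eq_sum s y)
  have hmgf : mgf L μ = mgf L ν := by
    ext s
    rw [mgf, mgf, hL]
    exact heq _
  have hset : integrableExpSet L μ = Set.univ := by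
    refine Set.eq_univ_of_forall fun s => ?_
    rw [integrableExpSet, Set.mem_ofPred_eq, hL]
    exact hμ _
  have hzero : μ = 0 ↔ ν = 0 := by
    have h0 : μ.real Set.univ = ν.real Set.univ := by simpa [mgf] using congrFun hmgf 0
    rw [← Measure.measure_univ_eq_zero, ← Measure.measure_univ_eq_zero,
      ← measureReal_eq_zero_iff, ← measureReal_eq_zero_iff, h0]
  have hc := eqOn_complexMGF_of_mgf' hmgf hzero
    (x := ((1 : ℝ) : ℂ) * Complex.I) (by simp [hset])
  rw [complexMGF_mul_I (by fun_prop), complexMGF_mul_I (by fun_prop)] at hc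
  rw [charFunDual_eq_charFun_map_one, charFunDual_eq_charFun_map_one, hc]

/-- A function in `L²(γ)` orthogonal to all exponentials vanishes. -/
lemma ae_eq_zero_of_integral_mul_exp_eq_zero {d : ℕ} {f : Euc d → ℝ} (hfm : Measurable f)
    (hf : MemLp f 2 (_root_.stdGaussian d))
    (h0 : ∀ h : Euc d, ∫ y, f y * Real.exp (∑ i, h i * y i) ∂(_root_.stdGaussian d) = 0) :
    f =ᵐ[_root_.stdGaussian d] 0 := by
  have hfi : Integrable f (_root_.stdGaussian d) := hf.integrable one_le_two
  have hint {u : Euc d → ℝ} (hum : Measurable u) (hu : MemLp u 2 (_root_.stdGaussian d))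
      (h : Euc d) : Integrable (fun y => Real.exp (∑ i, h i * y i))
        ((_root_.stdGaussian d).withDensity fun y => ENNReal.ofReal (u y)) := by
    rw [integrable_withDensity_iff_integrable_smul' hum.ennreal_ofReal (by simp)]
    simp_rw [ENNReal.toReal_ofReal', smul_eq_mul]
    exact hu.pos_part.integrable_mul (memLp_exp h)
  have hval {u : Euc d → ℝ} (hum : Measurable u) (h : Euc d) :
      ∫ y, Real.exp (∑ i, h i * y i)
        ∂((_root_.stdGaussian d).withDensity fun y => ENNReal.ofReal (u y)) =
      ∫ y, max (u y) 0 * Real.exp (∑ i, h i * y i) ∂(_root_.stdGaussian d) := by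
    rw [integral_withDensity_eq_integral_toReal_smul hum.ennreal_ofReal (by simp)]
    simp_rw [ENNReal.toReal_ofReal', smul_eq_mul]
  have := isFiniteMeasure_withDensity_ofReal hfi.2
  have := isFiniteMeasure_withDensity_ofReal hfi.neg.2
  have heq : (_root_.stdGaussian d).withDensity (fun y => ENNReal.ofReal (f y)) =
      (_root_.stdGaussian d).withDensity (fun y => ENNReal.ofReal ((-f) y)) := by
    refine Measure.ext_of_integral_exp (hint hfm hf) fun h => ?_
    rw [hval hfm, hval hfm.neg, ← sub_eq_zero]
    refine Eq.trans ((integral_sub (hf.pos_part.integrable_mul (memLp_exp h))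
      (hf.neg.pos_part.integrable_mul (memLp_exp h))).symm.trans
        (integral_congr_ae (.of_forall fun y => ?_))) (h0 h)
    simp only [Pi.mul_apply]
    rw [← sub_mul, Pi.neg_apply]
    congr 1
    rcases le_total 0 (f y) with hy | hy
    · rw [max_eq_left hy, max_eq_right (by linarith), sub_zero]
    · rw [max_eq_right hy, max_eq_left (by linarith)]
      ring
  rw [withDensity_eq_iff hfm.ennreal_ofReal.aemeasurable hfm.neg.ennreal_ofReal.aemeasurable
    hfi.lintegral_lt_top.ne] at heq
  filter_upwards [heq] with y hy
  rcases le_total 0 (f y) with h | h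
  · rw [Pi.neg_apply, ENNReal.ofReal_of_nonpos (by linarith : -f y ≤ 0),
      ENNReal.ofReal_eq_zero] at hy
    exact le_antisymm hy h
  · rw [Pi.neg_apply, ENNReal.ofReal_of_nonpos h, eq_comm, ENNReal.ofReal_eq_zero] at hy
    exact le_antisymm h (by simpa using hy)

lemma MeasureTheory.MemLp.inner_toLp {X : Type*} [MeasurableSpace X] {μ : Measure X}
    {f g : X → ℝ} (hf : MemLp f 2 μ) (hg : MemLp g 2 μ) :
    inner ℝ (hf.toLp f) (hg.toLp g) = ∫ y, f y * g y ∂μ := by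
  rw [L2.inner_def]
  refine integral_congr_ae ?_
  filter_upwards [hf.coeFn_toLp, hg.coeFn_toLp] with y h1 h2
  rw [h1, h2]
  simp [mul_comm]

/-- The normalized Hermite polynomial `H_α / √α!` as an element of `L²(γ)`. -/
def hermiteL2 {d : ℕ} (α : Fin d → ℕ) : Lp ℝ 2 (_root_.stdGaussian d) :=
  (√(mfact α))⁻¹ • (memLp_hermiteM α).toLp

lemma mfact_pos {d : ℕ} (α : Fin d → ℕ) : (0 : ℝ) < mfact α :=
  Nat.cast_pos.2 (Finset.prod_pos fun i _ => Nat.factorial_pos (α i))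

lemma orthonormal_hermiteL2 (d : ℕ) : Orthonormal ℝ (hermiteL2 (d := d)) := by
  rw [orthonormal_iff_ite]
  intro α β
  rw [hermiteL2, hermiteL2, real_inner_smul_left, real_inner_smul_right, MemLp.inner_toLp,
    integral_hermiteM_mul_hermiteM]
  split_ifs with h
  · subst h
    have := mfact_pos α
    rw [← mul_assoc, ← mul_inv, Real.mul_self_sqrt this.le, inv_mul_cancel₀ this.ne']
  · simp

/-- If the Bessel sums of `y` over some finite sets converge to `‖y‖²`, then every vector orthogonal
to the orthonormal family is orthogonal to `y`. -/
lemma Orthonormal.inner_eq_zero_of_tendsto {E ι : Type*} [NormedAddCommGroup E]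
    [InnerProductSpace ℝ E] {v : ι → E} (hv : Orthonormal ℝ v) {x y : E} {s : ℕ → Finset ι}
    (hs : Filter.Tendsto (fun N => ∑ i ∈ s N, inner ℝ (v i) y ^ 2) Filter.atTop (𝓝 (‖y‖ ^ 2)))
    (hx : ∀ i, inner ℝ (v i) x = 0) : inner ℝ x y = 0 := by
  have hsq (N : ℕ) : ‖y - ∑ i ∈ s N, inner ℝ (v i) y • v i‖ ^ 2 =
      ‖y‖ ^ 2 - ∑ i ∈ s N, inner ℝ (v i) y ^ 2 := by
    have h1 : inner ℝ y (∑ i ∈ s N, inner ℝ (v i) y • v i) =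
        ∑ i ∈ s N, inner ℝ (v i) y ^ 2 := by
      rw [inner_sum]
      refine Finset.sum_congr rfl fun i _ => ?_
      rw [real_inner_smul_right, real_inner_comm, sq]
    have h2 : ‖∑ i ∈ s N, inner ℝ (v i) y • v i‖ ^ 2 = ∑ i ∈ s N, inner ℝ (v i) y ^ 2 := by
      rw [← real_inner_self_eq_norm_sq, hv.inner_sum]
      simp [sq]
    rw [norm_sub_sq_real, h1, h2]
    ring
  have hinner (N : ℕ) : inner ℝ x y = inner ℝ x (y - ∑ i ∈ s N, inner ℝ (v i) y • v i) := by
    rw [inner_sub_right, inner_sum, Finset.sum_eq_zero, sub_zero]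
    intro i _
    rw [real_inner_smul_right, real_inner_comm (v i) x, hx, mul_zero]
  have hle (N : ℕ) : inner ℝ x y ^ 2 ≤
      ‖x‖ ^ 2 * (‖y‖ ^ 2 - ∑ i ∈ s N, inner ℝ (v i) y ^ 2) := by
    rw [← hsq, ← mul_pow, hinner N, ← sq_abs]
    gcongr
    exact abs_real_inner_le_norm _ _
  have hlim := (hs.const_sub (‖y‖ ^ 2)).const_mul (‖x‖ ^ 2)
  rw [sub_self, mul_zero] at hlim
  exact pow_eq_zero_iff two_ne_zero |>.1 (le_antisymm (ge_of_tendsto' hlim hle) (sq_nonneg _))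

lemma tendsto_sum_inner_hermiteL2_exp {d : ℕ} (h : Euc d) :
    Filter.Tendsto (fun N => ∑ α ∈ Fintype.piFinset fun _ : Fin d => Finset.range N,
      inner ℝ (hermiteL2 α) ((memLp_exp h).toLp) ^ 2) Filter.atTop
      (𝓝 (‖(memLp_exp h).toLp‖ ^ 2)) := by
  have hnorm : ‖(memLp_exp h).toLp‖ ^ 2 = ∏ i, (Real.exp (h i ^ 2) * Real.exp (h i ^ 2)) := by
    rw [← real_inner_self_eq_norm_sq, MemLp.inner_toLp, ← integral_exp_sq]
    simp_rw [sq]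
  have hterm (α : Fin d → ℕ) : inner ℝ (hermiteL2 α) ((memLp_exp h).toLp) ^ 2 =
      ∏ i, ((h i ^ 2) ^ α i / (α i).factorial * Real.exp (h i ^ 2)) := by
    rw [hermiteL2, real_inner_smul_left, MemLp.inner_toLp, integral_hermiteM_mul_exp, mul_pow,
      inv_pow, Real.sq_sqrt (mfact_pos α).le, mfact, Nat.cast_prod, ← Finset.prod_inv_distrib,
      ← Finset.prod_pow, ← Finset.prod_mul_distrib]
    refine Finset.prod_congr rfl fun i _ => ?_
    rw [mul_pow, ← Real.exp_nat_mul, ← pow_mul, ← pow_mul, mul_comm 2 (α i), div_eq_inv_mul]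
    push_cast
    ring_nf
  simp_rw [hnorm, hterm, ← Finset.prod_univ_sum (fun _ : Fin d => Finset.range _)
    (fun i n => (h i ^ 2) ^ n / n.factorial * Real.exp (h i ^ 2))]
  refine tendsto_finsetProd _ fun i _ => ?_
  simp_rw [← Finset.sum_mul]
  refine Filter.Tendsto.mul_const _ ?_
  rw [Real.exp_eq_exp_ℝ]
  exact (NormedSpace.expSeries_div_hasSum_exp (h i ^ 2)).tendsto_sum_nat

lemma span_hermiteL2_orthogonal (d : ℕ) :
    (Submodule.span ℝ (Set.range (hermiteL2 (d := d))))ᗮ = ⊥ := by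
  rw [Submodule.eq_bot_iff]
  intro f hf
  rw [Submodule.mem_orthogonal] at hf
  have hf' (α : Fin d → ℕ) : inner ℝ (hermiteL2 α) f = 0 :=
    hf _ (Submodule.subset_span ⟨α, rfl⟩)
  have h0 (h : Euc d) : ∫ y, f y * Real.exp (∑ i, h i * y i) ∂(_root_.stdGaussian d) = 0 := by
    rw [← MemLp.inner_toLp (Lp.memLp f) (memLp_exp h), Lp.toLp_coeFn]
    exact (orthonormal_hermiteL2 d).inner_eq_zero_of_tendsto
      (tendsto_sum_inner_hermiteL2_exp h) hf'
  exact (Lp.eq_zero_iff_ae_eq_zero).2 (ae_eq_zero_of_integral_mul_exp_eq_zero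
    (Lp.stronglyMeasurable f).measurable (Lp.memLp f) h0)

/-- Parseval's identity for the Hermite expansion in `L²(γ)`. -/
lemma hasSum_integral_mul_hermiteM_sq {d : ℕ} {f : Euc d → ℝ}
    (hf : MemLp f 2 (_root_.stdGaussian d)) :
    HasSum (fun α => (∫ y, f y * hermiteM α y ∂(_root_.stdGaussian d)) ^ 2 / mfact α)
      (∫ y, f y ^ 2 ∂(_root_.stdGaussian d)) := by
  have h := (HilbertBasis.mkOfOrthogonalEqBot (orthonormal_hermiteL2 d)
    (span_hermiteL2_orthogonal d)).hasSum_inner_mul_inner (hf.toLp f) (hf.toLp f)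
  rw [MemLp.inner_toLp] at h
  simp_rw [HilbertBasis.coe_mkOfOrthogonalEqBot, ← sq] at h
  refine h.congr_fun fun α => ?_
  rw [real_inner_comm (hf.toLp f), ← sq, hermiteL2, real_inner_smul_right, MemLp.inner_toLp,
    mul_pow, inv_pow, Real.sq_sqrt (mfact_pos α).le, div_eq_inv_mul]

/-- The product `∏ᵢ He_{βᵢ}(yᵢ) ρ(yᵢ)` of Hermite functions on `ℝ^d`. -/
def hermiteGaussianM {d : ℕ} (β : Fin d → ℕ) (y : Euc d) : ℝ := ∏ i, hermiteGaussian (β i) (y i)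

lemma continuous_hermiteGaussianM {d : ℕ} (β : Fin d → ℕ) : Continuous (hermiteGaussianM β) :=
  continuous_finsetProd _ fun i _ => (continuous_hermiteGaussian _).comp (by fun_prop)

lemma hasFDerivAt_hermiteGaussianM {d : ℕ} (β : Fin d → ℕ) (y : Euc d) :
    HasFDerivAt (hermiteGaussianM β)
      (-∑ i, hermiteGaussianM (β + Pi.single i 1) y • (EuclideanSpace.proj i : Euc d →L[ℝ] ℝ)) y := by
  have hcoord (i : Fin d) : HasFDerivAt (fun y : Euc d => hermiteGaussian (β i) (y i))
      (-hermiteGaussian (β i + 1) (y i) • (EuclideanSpace.proj i : Euc d →L[ℝ] ℝ)) y :=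
    HasDerivAt.comp_hasFDerivAt (f := fun y : Euc d => y i) y
      (hasDerivAt_hermiteGaussian (β i) (y i))
      (EuclideanSpace.proj i : Euc d →L[ℝ] ℝ).hasFDerivAt
  have h := HasFDerivAt.finsetProd (u := Finset.univ) fun i _ => hcoord i
  refine h.congr_fderiv ?_
  rw [← Finset.sum_neg_distrib]
  refine Finset.sum_congr rfl fun i _ => ?_
  rw [smul_smul, ← neg_smul]
  congr 1
  rw [hermiteGaussianM, ← Finset.mul_prod_erase _ _ (Finset.mem_univ i)]
  have : ∏ j ∈ Finset.univ.erase i, hermiteGaussian ((β + Pi.single i 1 : Fin d → ℕ) j) (y j) =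
      ∏ j ∈ Finset.univ.erase i, hermiteGaussian (β j) (y j) := by
    refine Finset.prod_congr rfl fun j hj => ?_
    simp [Pi.single_eq_of_ne (Finset.ne_of_mem_erase hj)]
  rw [this]
  simp
  ring

lemma integrable_hermiteGaussianM {d : ℕ} (β : Fin d → ℕ) : Integrable (hermiteGaussianM β) :=
  EuclideanSpace.integrable_prod fun i => by
    simpa using integrable_hermiteGaussian_mul (β i) (u := fun _ => 1)
      aestronglyMeasurable_const (C := 1) (A := 0) (by simp)

lemma exists_abs_hermiteGaussianM_sub_le {d : ℕ} (β : Fin d → ℕ) :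
    ∃ C, 0 ≤ C ∧ ∀ a y : Euc d,
      |hermiteGaussianM β (y - a)| ≤ C * Real.exp ‖a‖ ^ d * ∏ i, Real.exp (-|y i|) := by
  choose C hC h using fun i => exists_abs_hermiteGaussian_le (β i) 1
  refine ⟨∏ i, C i, Finset.prod_nonneg fun i _ => hC i, fun a y => ?_⟩
  have hcard : Real.exp ‖a‖ ^ d = ∏ _i : Fin d, Real.exp ‖a‖ := by simp
  rw [hermiteGaussianM, Finset.abs_prod, hcard, ← Finset.prod_mul_distrib,
    ← Finset.prod_mul_distrib]
  refine Finset.prod_le_prod (fun i _ => abs_nonneg _) fun i _ => (h i _).trans ?_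
  rw [mul_assoc, ← Real.exp_add]
  refine mul_le_mul_of_nonneg_left (Real.exp_le_exp.2 ?_) (hC i)
  have h1 : |a i| ≤ ‖a‖ := PiLp.norm_apply_le a i
  have h2 : |y i| ≤ |y i - a i| + |a i| := by
    simpa using abs_add_le (y i - a i) (a i)
  rw [one_mul, PiLp.sub_apply]
  linarith

lemma hasFDerivAt_integral_mul_hermiteGaussianM {d : ℕ} {ψ : Euc d → ℝ} (hψm : Measurable ψ)
    {B : ℝ} (hψ : ∀ y, |ψ y| ≤ B) (r : ℝ) (β : Fin d → ℕ) (x : Euc d) :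
    HasFDerivAt (fun x => ∫ y, ψ y * hermiteGaussianM β (y - r • x))
      (∑ i, (r * ∫ y, ψ y * hermiteGaussianM (β + Pi.single i 1) (y - r • x)) •
        (EuclideanSpace.proj i : Euc d →L[ℝ] ℝ)) x := by
  have hB : 0 ≤ B := (abs_nonneg _).trans (hψ 0)
  have hint (β : Fin d → ℕ) (x : Euc d) :
      Integrable fun y => ψ y * hermiteGaussianM β (y - r • x) :=
    ((integrable_hermiteGaussianM β).comp_sub_right (r • x)).bdd_mul (c := B)
      hψm.aestronglyMeasurable (.of_forall hψ)
  choose C hC hb using fun i => exists_abs_hermiteGaussianM_sub_le (β + Pi.single i 1)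
  let R : ℝ := |r| * (‖x‖ + 1)
  let F' (x y : Euc d) : Euc d →L[ℝ] ℝ :=
    ∑ i, (r * (ψ y * hermiteGaussianM (β + Pi.single i 1) (y - r • x))) •
      (EuclideanSpace.proj i : Euc d →L[ℝ] ℝ)
  have hproj (i : Fin d) : ‖(EuclideanSpace.proj i : Euc d →L[ℝ] ℝ)‖ ≤ 1 :=
    ContinuousLinearMap.opNorm_le_bound _ zero_le_one fun y => by
      simpa using PiLp.norm_apply_le y i
  have hmain := hasFDerivAt_integral_of_dominated_of_fderiv_le (μ := volume)
    (F := fun x y => ψ y * hermiteGaussianM β (y - r • x)) (F' := F') (x₀ := x)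
    (bound := fun y => ∑ i, |r| * (B * (C i * Real.exp R ^ d * ∏ j, Real.exp (-|y j|))))
    (Metric.ball_mem_nhds x one_pos) (.of_forall fun x => (hint β x).aestronglyMeasurable)
    (hint β x)
    (Finset.aestronglyMeasurable_fun_sum _ fun i _ =>
      ((hint _ x).aestronglyMeasurable.const_mul r).smul_const _)
    (.of_forall fun y z hz => ?_) ?_ (.of_forall fun y z _ => ?_)
  · refine hmain.congr_fderiv ?_
    have hF' (i : Fin d) : Integrable fun y =>
        (r * (ψ y * hermiteGaussianM (β + Pi.single i 1) (y - r • x))) •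
          (EuclideanSpace.proj i : Euc d →L[ℝ] ℝ) :=
      ((hint _ x).const_mul r).smul_const _
    simp only [F']
    rw [integral_finsetSum _ fun i _ => hF' i]
    simp_rw [integral_smul_const, integral_const_mul]
  · refine (norm_sum_le _ _).trans (Finset.sum_le_sum fun i _ => ?_)
    have hzR : ‖r • z‖ ≤ R := by
      rw [norm_smul, Real.norm_eq_abs]
      have : ‖z‖ ≤ ‖x‖ + 1 := by
        have := norm_le_norm_add_norm_sub' z x
        rw [Metric.mem_ball, dist_eq_norm] at hz
        linarith
      exact mul_le_mul_of_nonneg_left this (abs_nonneg r)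
    rw [norm_smul, Real.norm_eq_abs, abs_mul, abs_mul]
    refine (mul_le_of_le_one_right (by positivity) (hproj i)).trans ?_
    have hCi := hC i
    gcongr
    · exact hψ y
    · refine (hb i _ _).trans ?_
      have hexp : Real.exp ‖r • z‖ ^ d ≤ Real.exp R ^ d := by gcongr
      exact mul_le_mul_of_nonneg_right (mul_le_mul_of_nonneg_left hexp hCi) (by positivity)
  · refine integrable_finsetSum _ fun i _ => ?_
    exact (((EuclideanSpace.integrable_prod fun _ => integrable_exp_neg_abs).const_mul _).const_mul
      _).const_mul _
  · have h1 : HasFDerivAt (fun z : Euc d => y - r • z) (-(r • ContinuousLinearMap.id ℝ (Euc d))) z :=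
      ((hasFDerivAt_id z).const_smul r).const_sub y
    have h2 := ((hasFDerivAt_hermiteGaussianM β (y - r • z)).comp z h1).const_mul (ψ y)
    refine h2.congr_fderiv ?_
    ext v
    simp [F', Finset.mul_sum]
    refine Finset.sum_congr rfl fun i _ => ?_
    ring

lemma pderivE_integral_mul_hermiteGaussianM {d : ℕ} {ψ : Euc d → ℝ} (hψm : Measurable ψ)
    {B : ℝ} (hψ : ∀ y, |ψ y| ≤ B) (r : ℝ) (β : Fin d → ℕ) (i : Fin d) :
    pderivE i (fun x => r ^ mdeg β * ∫ y, ψ y * hermiteGaussianM β (y - r • x)) =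
      fun x => r ^ mdeg (β + Pi.single i 1) *
        ∫ y, ψ y * hermiteGaussianM (β + Pi.single i 1) (y - r • x) := by
  ext x
  have hdeg : mdeg (β + Pi.single i 1) = mdeg β + 1 := by
    simp [mdeg, Finset.sum_add_distrib]
  rw [pderivE, ((hasFDerivAt_integral_mul_hermiteGaussianM hψm hψ r β x).const_mul _).fderiv, hdeg]
  simp
  ring

/-- Iterated partial derivatives of a family in which `∂ᵢ` shifts the multi-index by `eᵢ`. -/
lemma mderivE_eq_of_pderivE_eq {d : ℕ} {G : (Fin d → ℕ) → Euc d → ℝ}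
    (hG : ∀ β i, pderivE i (G β) = G (β + Pi.single i 1)) (α : Fin d → ℕ) :
    mderivE α (G 0) = G α := by
  have hiter (i : Fin d) (k : ℕ) (β : Fin d → ℕ) :
      (pderivE i)^[k] (G β) = G (β + Pi.single i k) := by
    induction k with
    | zero => simp
    | succ k ih =>
      rw [Function.iterate_succ_apply', ih, hG, add_assoc, ← Pi.single_add]
  have hlist (l : List (Fin d)) :
      ((l.map fun i => (pderivE i)^[α i]).foldr (· ∘ ·) id) (G 0) =
        G (l.map fun i => Pi.single i (α i)).sum := by
    induction l with
    | nil => simp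
    | cons i l ih =>
      rw [List.map_cons, List.foldr_cons, Function.comp_apply, ih, hiter, List.map_cons,
        List.sum_cons, add_comm]
  rw [mderivE, List.ofFn_eq_map, hlist, ← List.ofFn_eq_map, List.sum_ofFn,
    Finset.univ_sum_single]

lemma integral_mul_hermiteM_eq {d : ℕ} (f : Euc d → ℝ) (α : Fin d → ℕ) :
    ∫ y, f y * hermiteM α y ∂(_root_.stdGaussian d) = ∫ y, f y * hermiteGaussianM α y := by
  rw [integral_stdGaussian]
  congr with y
  simp only [hermiteM, hermiteGaussianM, hermiteGaussian, Finset.prod_mul_distrib]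
  ring

lemma mderivE_OU {d : ℕ} {t : ℝ} (ht : 0 < t) {φ : Euc d → ℝ} (hφm : Measurable φ) {B : ℝ}
    (hφ : ∀ y, |φ y| ≤ B) (α : Fin d → ℕ) (x : Euc d) :
    mderivE α (OU t φ) x = (Real.exp (-t) / √(1 - Real.exp (-2 * t))) ^ mdeg α *
      ∫ y, φ (Real.exp (-t) • x + √(1 - Real.exp (-2 * t)) • y) * hermiteM α y
        ∂(_root_.stdGaussian d) := by
  set s := √(1 - Real.exp (-2 * t)) with hs
  set r := Real.exp (-t) / s with hr
  have hspos : 0 < s := Real.sqrt_pos.2 (sub_pos.2 (Real.exp_lt_one_iff.2 (by linarith)))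
  have hrs : s * r = Real.exp (-t) := by rw [hr]; field_simp
  have htrans (β : Fin d → ℕ) (x : Euc d) :
      ∫ y, φ (Real.exp (-t) • x + s • y) * hermiteM β y ∂(_root_.stdGaussian d) =
        ∫ y, φ (s • y) * hermiteGaussianM β (y - r • x) := by
    rw [integral_mul_hermiteM_eq, ← integral_sub_right_eq_self _ (r • x)]
    congr with y
    rw [smul_sub, smul_smul, hrs, add_sub_cancel]
  have hG := mderivE_eq_of_pderivE_eq
    (pderivE_integral_mul_hermiteGaussianM (ψ := fun y => φ (s • y)) (by fun_prop)
      (fun y => hφ (s • y)) r) α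
  have h0 : OU t φ = fun x => r ^ mdeg (0 : Fin d → ℕ) *
      ∫ y, φ (s • y) * hermiteGaussianM 0 (y - r • x) := by
    ext x
    rw [← htrans]
    simp [OU, mdeg, hermiteM, hermiteR, hs]
  rw [h0, hG, htrans]

theorem OU_deriv_sum_eq
    {d : ℕ} (t : ℝ) (ht : 0 < t)
    (g : Euc d → Euc d) (hgm : Measurable g) (hgb : ∃ C : ℝ, ∀ x, ‖g x‖ ≤ C)
    (x : Euc d) :
    (∑' α : Fin d → ℕ, ENNReal.ofReal ((Real.exp (2 * t) - 1) ^ mdeg α / (mfact α : ℝ) *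
        ‖mderivVec α (fun y => OUvec t g y) x‖ ^ 2)) =
      ENNReal.ofReal (OU t (fun y => ‖g y‖ ^ 2) x) := by
  obtain ⟨B, hB⟩ := hgb
  set s := √(1 - Real.exp (-2 * t)) with hs
  let f (i : Fin d) (y : Euc d) : ℝ := g (Real.exp (-t) • x + s • y) i
  have hgi (i : Fin d) : Measurable fun y => g y i := by fun_prop
  have hgiB (i : Fin d) (y : Euc d) : |g y i| ≤ B := (PiLp.norm_apply_le (g y) i).trans (hB y)
  have hfL (i : Fin d) : MemLp (f i) 2 (_root_.stdGaussian d) :=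
    .of_bound ((hgi i).comp (by fun_prop)).aestronglyMeasurable B
      (.of_forall fun y => hgiB i (Real.exp (-t) • x + s • y))
  have hcomp (i : Fin d) : (fun y => OUvec t g y i) = OU t fun y => g y i := by
    ext y
    refine ((EuclideanSpace.proj i : Euc d →L[ℝ] ℝ).integral_comp_comm
      (.of_bound (hgm.comp (by fun_prop)).aestronglyMeasurable B (.of_forall fun z => hB _))).symm
  have hexp : (Real.exp (2 * t) - 1) * (Real.exp (-t) / s) ^ 2 = 1 := by
    have h1 : Real.exp (-2 * t) < 1 := Real.exp_lt_one_iff.2 (by linarith)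
    have h2 : Real.exp (2 * t) * Real.exp (-2 * t) = 1 := by
      rw [← Real.exp_add]
      simp
    have h3 : Real.exp (-t) ^ 2 = Real.exp (-2 * t) := by
      rw [← Real.exp_nat_mul]
      push_cast
      ring_nf
    rw [div_pow, hs, Real.sq_sqrt (by linarith), h3, mul_div_assoc', div_eq_one_iff_eq (by linarith)]
    linarith
  have hterm (α : Fin d → ℕ) : (Real.exp (2 * t) - 1) ^ mdeg α / (mfact α : ℝ) *
      ‖mderivVec α (fun y => OUvec t g y) x‖ ^ 2 =
        ∑ i, (∫ y, f i y * hermiteM α y ∂(_root_.stdGaussian d)) ^ 2 / mfact α := by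
    rw [EuclideanSpace.norm_sq_eq, Finset.mul_sum]
    refine Finset.sum_congr rfl fun i _ => ?_
    have : mderivVec α (fun y => OUvec t g y) x i = (Real.exp (-t) / s) ^ mdeg α *
        ∫ y, f i y * hermiteM α y ∂(_root_.stdGaussian d) := by
      rw [← mderivE_OU ht (hgi i) (hgiB i), ← hcomp]
      rfl
    rw [this, Real.norm_eq_abs, sq_abs, mul_pow, ← mul_assoc, div_mul_eq_mul_div, ← pow_mul,
      mul_comm (mdeg α) 2, pow_mul, ← mul_pow, hexp, one_pow, one_div_mul_eq_div]
  have hsum := hasSum_sum (s := Finset.univ) fun i _ => hasSum_integral_mul_hermiteM_sq (hfL i)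
  have htot : ∑ i, ∫ y, f i y ^ 2 ∂(_root_.stdGaussian d) = OU t (fun y => ‖g y‖ ^ 2) x := by
    rw [OU, ← integral_finsetSum _ fun i _ => (hfL i).integrable_sq]
    simp_rw [EuclideanSpace.norm_sq_eq, Real.norm_eq_abs, sq_abs]
    rfl
  rw [← htot, ← hsum.tsum_eq]
  simp_rw [hterm]
  exact (ENNReal.ofReal_tsum_of_nonneg (fun α => by positivity) hsum.summable).symm

end
end

section
/- Let t > 0, let φ : ℝ^d → ℝ be bounded and measurable, and let α ∈ ℕ^d be a multi-index. Then P_t φ is C^∞ and for every x ∈ ℝ^d, ∂^α P_t φ(x) = (e^{2t} − 1)^{-|α|/2} ∫_{ℝ^d} H_α(y) φ(e^{-t} x + √(1 − e^{-2t}) y) dγ(y). -/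
open MeasureTheory ProbabilityTheory Real
open scoped ENNReal NNReal BigOperators Topology Classical

noncomputable section

lemma polynomial_abs_le_mul_exp (p : Polynomial ℤ) :
    ∃ K : ℝ, 0 ≤ K ∧ ∀ x : ℝ, |Polynomial.aeval x p| ≤ K * Real.exp (x ^ 2 / 4) := by
  induction p using Polynomial.induction_on' with
  | add p q hp hq =>
    obtain ⟨K, hK, hp⟩ := hp
    obtain ⟨L, hL, hq⟩ := hq
    refine ⟨K + L, by positivity, fun x => ?_⟩
    rw [map_add, add_mul]
    exact (abs_add_le _ _).trans (add_le_add (hp x) (hq x))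
  | monomial n a =>
    refine ⟨|(a : ℝ)| * (n.factorial * Real.exp 1), by positivity, fun x => ?_⟩
    have h₁ := Real.pow_div_factorial_le_exp |x| (abs_nonneg x) n
    rw [div_le_iff₀ (by positivity)] at h₁
    have h₂ : Real.exp |x| ≤ Real.exp 1 * Real.exp (x ^ 2 / 4) := by
      rw [← Real.exp_add]
      gcongr
      nlinarith [sq_abs x, sq_nonneg (|x| - 2)]
    simp only [Polynomial.aeval_monomial, abs_mul, abs_pow, eq_intCast]
    rw [mul_assoc]
    gcongr
    calc |x| ^ n ≤ Real.exp |x| * n.factorial := h₁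
      _ ≤ (Real.exp 1 * Real.exp (x ^ 2 / 4)) * n.factorial := by gcongr
      _ = n.factorial * Real.exp 1 * Real.exp (x ^ 2 / 4) := by ring

/-- The Hermite function `H_k(x) exp(-x²/2)`. -/
def hermiteGauss (k : ℕ) (x : ℝ) : ℝ := hermiteR k x * Real.exp (-x ^ 2 / 2)

lemma hasDerivAt_hermiteGauss (k : ℕ) (x : ℝ) :
    HasDerivAt (hermiteGauss k) (-hermiteGauss (k + 1) x) x := by
  have h₁ := Polynomial.hasDerivAt_aeval (Polynomial.hermite k) x
  have h₂ : HasDerivAt (fun x : ℝ => Real.exp (-x ^ 2 / 2)) (Real.exp (-x ^ 2 / 2) * (-x)) x := by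
    refine HasDerivAt.exp ?_
    refine ((hasDerivAt_pow 2 x).neg.div_const 2).congr_deriv ?_
    norm_num
    ring
  refine (h₁.mul h₂).congr_deriv ?_
  simp only [hermiteGauss, hermiteR, Polynomial.hermite_succ, map_sub, map_mul,
    Polynomial.aeval_X]
  ring

lemma hermiteGauss_abs_le (k : ℕ) :
    ∃ K : ℝ, 0 ≤ K ∧ ∀ x : ℝ, |hermiteGauss k x| ≤ K * Real.exp (-x ^ 2 / 4) := by
  obtain ⟨K, hK, h⟩ := polynomial_abs_le_mul_exp (Polynomial.hermite k)
  refine ⟨K, hK, fun x => ?_⟩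
  rw [hermiteGauss, abs_mul, Real.abs_exp]
  calc _ ≤ K * Real.exp (x ^ 2 / 4) * Real.exp (-x ^ 2 / 2) := by
        gcongr
        exact h x
    _ = K * Real.exp (-x ^ 2 / 4) := by
        rw [mul_assoc, ← Real.exp_add]
        ring_nf

/-- The multivariate Hermite function `H_β(y) exp(-‖y‖²/2)`. -/
def hermiteGaussM {d : ℕ} (β : Fin d → ℕ) (y : Euc d) : ℝ := ∏ i, hermiteGauss (β i) (y i)

lemma hermiteGaussM_eq {d : ℕ} (β : Fin d → ℕ) (y : Euc d) :
    hermiteGaussM β y = hermiteM β y * Real.exp (-‖y‖ ^ 2 / 2) := by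
  simp only [hermiteGaussM, hermiteGauss, Finset.prod_mul_distrib, hermiteM, ← Real.exp_sum,
    EuclideanSpace.real_norm_sq_eq, ← Finset.sum_div, Finset.sum_neg_distrib]

lemma hasFDerivAt_hermiteGaussM {d : ℕ} (β : Fin d → ℕ) (y : Euc d) :
    HasFDerivAt (hermiteGaussM β)
      (∑ i, (-hermiteGaussM (β + Pi.single i 1) y) •
        (EuclideanSpace.proj i : Euc d →L[ℝ] ℝ)) y := by
  have h (i : Fin d) : HasFDerivAt (fun y : Euc d => hermiteGauss (β i) (y i))
      ((-hermiteGauss (β i + 1) (y i)) • (EuclideanSpace.proj i : Euc d →L[ℝ] ℝ)) y :=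
    HasDerivAt.comp_hasFDerivAt (f := fun y : Euc d => y i) y
      (hasDerivAt_hermiteGauss (β i) (y i)) (EuclideanSpace.proj i : Euc d →L[ℝ] ℝ).hasFDerivAt
  have hprod := HasFDerivAt.finsetProd (u := Finset.univ) fun i _ => h i
  refine hprod.congr_fderiv ?_
  refine Finset.sum_congr rfl fun i _ => ?_
  rw [smul_smul]
  congr 1
  rw [hermiteGaussM, ← Finset.prod_erase_mul _ _ (Finset.mem_univ i)]
  simp only [Pi.add_apply, Pi.single_eq_same, mul_neg]
  congr 2
  refine Finset.prod_congr rfl fun j hj => ?_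
  simp [Finset.ne_of_mem_erase hj]

lemma continuous_hermiteGaussM {d : ℕ} (β : Fin d → ℕ) : Continuous (hermiteGaussM β) :=
  continuous_iff_continuousAt.2 fun y => (hasFDerivAt_hermiteGaussM β y).continuousAt

lemma hermiteGaussM_abs_mul_pow_le {d : ℕ} (β : Fin d → ℕ) (m : ℕ) :
    ∃ K : ℝ, 0 ≤ K ∧ ∀ y : Euc d, |hermiteGaussM β y| * (1 + ‖y‖) ^ m ≤ K := by
  choose K hK h using fun i => hermiteGauss_abs_le (β i)
  refine ⟨(∏ i, K i) * (m.factorial * Real.exp 2),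
    mul_nonneg (Finset.prod_nonneg fun i _ => hK i) (by positivity), fun y => ?_⟩
  have h₁ : |hermiteGaussM β y| ≤ (∏ i, K i) * Real.exp (-‖y‖ ^ 2 / 4) := by
    rw [hermiteGaussM, Finset.abs_prod, EuclideanSpace.real_norm_sq_eq, ← Finset.sum_neg_distrib,
      Finset.sum_div, Real.exp_sum, ← Finset.prod_mul_distrib]
    exact Finset.prod_le_prod (fun i _ => abs_nonneg _) fun i _ => h i (y i)
  have h₂ : (1 + ‖y‖) ^ m ≤ m.factorial * Real.exp 2 * Real.exp (‖y‖ ^ 2 / 4) := by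
    have h₃ := Real.pow_div_factorial_le_exp (1 + ‖y‖) (by positivity) m
    rw [div_le_iff₀ (by positivity)] at h₃
    rw [mul_assoc, ← Real.exp_add, mul_comm]
    refine h₃.trans (mul_le_mul_of_nonneg_right (Real.exp_le_exp.2 ?_) (by positivity))
    nlinarith [sq_nonneg (‖y‖ - 2)]
  have hKn : 0 ≤ ∏ i, K i := Finset.prod_nonneg fun i _ => hK i
  calc _ ≤ ((∏ i, K i) * Real.exp (-‖y‖ ^ 2 / 4)) *
        (m.factorial * Real.exp 2 * Real.exp (‖y‖ ^ 2 / 4)) := by gcongr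
    _ = (∏ i, K i) * (m.factorial * Real.exp 2) *
        (Real.exp (-‖y‖ ^ 2 / 4) * Real.exp (‖y‖ ^ 2 / 4)) := by ring
    _ = _ := by
        rw [← Real.exp_add, neg_div, neg_add_cancel, Real.exp_zero, mul_one]

lemma hermiteGaussM_sub_abs_le {d : ℕ} (β : Fin d → ℕ) (R : ℝ) :
    ∃ K : ℝ, 0 ≤ K ∧ ∀ u v : Euc d, ‖v‖ ≤ R →
      |hermiteGaussM β (u - v)| ≤ K * (1 + ‖u‖) ^ (-(d + 1 : ℝ)) := by
  obtain ⟨K, hK, h⟩ := hermiteGaussM_abs_mul_pow_le β (d + 1)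
  refine ⟨K * (1 + |R|) ^ (d + 1), by positivity, fun u v hv => ?_⟩
  have h₁ : (1 + ‖u‖) ≤ (1 + ‖u - v‖) * (1 + |R|) := by
    have := norm_le_norm_sub_add u v
    nlinarith [le_abs_self R, norm_nonneg (u - v), abs_nonneg R,
      mul_nonneg (norm_nonneg (u - v)) (abs_nonneg R)]
  have h₂ : (1 + ‖u‖) ^ (-(d + 1 : ℝ)) = ((1 + ‖u‖) ^ (d + 1))⁻¹ := by
    rw [Real.rpow_neg (by positivity), ← Real.rpow_natCast]
    push_cast
    rfl
  rw [h₂, ← div_eq_mul_inv, le_div_iff₀ (by positivity)]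
  calc |hermiteGaussM β (u - v)| * (1 + ‖u‖) ^ (d + 1)
      ≤ |hermiteGaussM β (u - v)| * ((1 + ‖u - v‖) * (1 + |R|)) ^ (d + 1) := by gcongr
    _ = |hermiteGaussM β (u - v)| * (1 + ‖u - v‖) ^ (d + 1) * (1 + |R|) ^ (d + 1) := by
        rw [mul_pow, mul_assoc]
    _ ≤ _ := by
        gcongr
        exact h _

attribute [irreducible] hermiteGaussM

/-- The smoothing `x ↦ b^|β| ∫ ψ(u) H_β(u - bx) exp(-‖u - bx‖²/2) du`. -/
def hermiteSmooth {d : ℕ} (b : ℝ) (ψ : Euc d → ℝ) (β : Fin d → ℕ) (x : Euc d) : ℝ :=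
  b ^ mdeg β * ∫ u, ψ u * hermiteGaussM β (u - b • x)

lemma mdeg_add {d : ℕ} (α β : Fin d → ℕ) : mdeg (α + β) = mdeg α + mdeg β :=
  Finset.sum_add_distrib

lemma mdeg_single {d : ℕ} (i : Fin d) (k : ℕ) : mdeg (Pi.single i k) = k := by
  simp [mdeg]

lemma integrable_mul_hermiteGaussM {d : ℕ} {ψ : Euc d → ℝ} (hψm : Measurable ψ) {C : ℝ}
    (hψ : ∀ x, |ψ x| ≤ C) (β : Fin d → ℕ) (v : Euc d) :
    Integrable fun u => ψ u * hermiteGaussM β (u - v) := by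
  obtain ⟨K, hK, h⟩ := hermiteGaussM_sub_abs_le β ‖v‖
  have hi : Integrable fun u : Euc d => (1 + ‖u‖) ^ (-(d + 1 : ℝ)) :=
    integrable_one_add_norm (by simp)
  refine (hi.const_mul (C * K)).mono'
    (hψm.mul ((continuous_hermiteGaussM β).measurable.comp
      (measurable_id.sub_const v))).aestronglyMeasurable (.of_forall fun u => ?_)
  rw [norm_mul, mul_assoc]
  exact mul_le_mul (hψ u) (h u v le_rfl) (abs_nonneg _) ((abs_nonneg _).trans (hψ u))

lemma hasFDerivAt_mul_hermiteGaussM_sub {d : ℕ} (b c : ℝ) (β : Fin d → ℕ) (u x : Euc d) :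
    HasFDerivAt (fun x : Euc d => c * hermiteGaussM β (u - b • x))
      (∑ i, (b * (c * hermiteGaussM (β + Pi.single i 1) (u - b • x))) •
        (EuclideanSpace.proj i : Euc d →L[ℝ] ℝ)) x := by
  have h₁ : HasFDerivAt (fun x : Euc d => u - b • x)
      (-(b • ContinuousLinearMap.id ℝ (Euc d))) x :=
    ((hasFDerivAt_id x).const_smul b).const_sub u
  refine (((hasFDerivAt_hermiteGaussM β (u - b • x)).comp x h₁).const_mul c).congr_fderiv ?_
  refine ContinuousLinearMap.ext fun v => ?_
  simp only [smul_apply, ContinuousLinearMap.comp_apply, sum_apply, neg_apply,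
    ContinuousLinearMap.id_apply,
    smul_eq_mul, map_neg, map_smul, mul_neg, ← Finset.sum_neg_distrib, Finset.mul_sum]
  refine Finset.sum_congr rfl fun i _ => ?_
  ring

lemma hasFDerivAt_integral_sum_smul {E X ι : Type*} [NormedAddCommGroup E] [NormedSpace ℝ E]
    [MeasurableSpace X] {μ : Measure X} [Fintype ι] {F : E → X → ℝ} {g : ι → E → X → ℝ}
    (ℓ : ι → E →L[ℝ] ℝ) {bound : ι → X → ℝ} {x₀ : E} {U : Set E} (hU : U ∈ 𝓝 x₀)
    (hF : ∀ x, Integrable (F x) μ) (hg : ∀ i, Integrable (g i x₀) μ)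
    (hbound : ∀ i u, ∀ x ∈ U, ‖g i x u‖ ≤ bound i u) (hbound_int : ∀ i, Integrable (bound i) μ)
    (hderiv : ∀ u x, HasFDerivAt (F · u) (∑ i, g i x u • ℓ i) x) :
    HasFDerivAt (fun x => ∫ u, F x u ∂μ) (∑ i, (∫ u, g i x₀ u ∂μ) • ℓ i) x₀ := by
  have hint (i : ι) : Integrable (fun u => g i x₀ u • ℓ i) μ := (hg i).smul_const _
  have key := hasFDerivAt_integral_of_dominated_of_fderiv_le hU
    (.of_forall fun x => (hF x).aestronglyMeasurable) (hF x₀)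
    (F' := fun x u => ∑ i, g i x u • ℓ i)
    (integrable_finsetSum Finset.univ (f := fun i u => g i x₀ u • ℓ i)
      fun i _ => hint i).aestronglyMeasurable
    (bound := fun u => ∑ i, bound i u * ‖ℓ i‖)
    (.of_forall fun u x hx => (norm_sum_le _ _).trans <| Finset.sum_le_sum fun i _ => by
      rw [norm_smul]
      gcongr
      exact hbound i u x hx)
    (integrable_finsetSum _ fun i _ => (hbound_int i).mul_const _)
    (.of_forall fun u x _ => hderiv u x)
  refine key.congr_fderiv ?_
  rw [integral_finsetSum _ fun i _ => hint i]
  simp only [integral_smul_const]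

lemma hasFDerivAt_hermiteSmooth {d : ℕ} (b : ℝ) {ψ : Euc d → ℝ} (hψm : Measurable ψ) {C : ℝ}
    (hψ : ∀ x, |ψ x| ≤ C) (β : Fin d → ℕ) (x₀ : Euc d) :
    HasFDerivAt (hermiteSmooth b ψ β)
      (∑ i, hermiteSmooth b ψ (β + Pi.single i 1) x₀ •
        (EuclideanSpace.proj i : Euc d →L[ℝ] ℝ)) x₀ := by
  choose K hK h using fun i : Fin d =>
    hermiteGaussM_sub_abs_le (β + Pi.single i 1) (|b| * (‖x₀‖ + 1))
  have hi : Integrable fun u : Euc d => (1 + ‖u‖) ^ (-(d + 1 : ℝ)) :=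
    integrable_one_add_norm (by simp)
  have hbound (i : Fin d) (u x : Euc d) (hx : x ∈ Metric.ball x₀ 1) :
      ‖b * (ψ u * hermiteGaussM (β + Pi.single i 1) (u - b • x))‖ ≤
        |b| * (C * (K i * (1 + ‖u‖) ^ (-(d + 1 : ℝ)))) := by
    rw [norm_mul, norm_mul]
    have hx' : ‖b • x‖ ≤ |b| * (‖x₀‖ + 1) := by
      rw [norm_smul, Real.norm_eq_abs]
      have := norm_le_norm_add_norm_sub' x x₀
      rw [mem_ball_iff_norm] at hx
      gcongr
      linarith
    have := h i u _ hx'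
    have hC : 0 ≤ C := (abs_nonneg _).trans (hψ u)
    simp only [Real.norm_eq_abs]
    gcongr
    exact hψ u
  have hbound_int (i : Fin d) :
      Integrable fun u : Euc d => |b| * (C * (K i * (1 + ‖u‖) ^ (-(d + 1 : ℝ)))) :=
    ((hi.const_mul (K i)).const_mul C).const_mul |b|
  have hg (i : Fin d) : Integrable fun u =>
      b * (ψ u * hermiteGaussM (β + Pi.single i 1) (u - b • x₀)) :=
    (integrable_mul_hermiteGaussM hψm hψ _ (b • x₀)).const_mul b
  have key := hasFDerivAt_integral_sum_smul (μ := (volume : Measure (Euc d)))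
    (F := fun x u => ψ u * hermiteGaussM β (u - b • x))
    (g := fun i x u => b * (ψ u * hermiteGaussM (β + Pi.single i 1) (u - b • x)))
    (fun i => (EuclideanSpace.proj i : Euc d →L[ℝ] ℝ))
    (Metric.ball_mem_nhds x₀ one_pos)
    (fun x => integrable_mul_hermiteGaussM hψm hψ β (b • x)) hg hbound hbound_int
    (fun u x => hasFDerivAt_mul_hermiteGaussM_sub b (ψ u) β u x)
  refine (key.const_mul (b ^ mdeg β)).congr_fderiv ?_
  rw [Finset.smul_sum]
  refine Finset.sum_congr rfl fun i _ => ?_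
  rw [integral_const_mul, smul_smul, hermiteSmooth, mdeg_add, mdeg_single, pow_succ, mul_assoc]

lemma contDiff_hermiteSmooth {d : ℕ} (b : ℝ) {ψ : Euc d → ℝ} (hψm : Measurable ψ) {C : ℝ}
    (hψ : ∀ x, |ψ x| ≤ C) (β : Fin d → ℕ) :
    ContDiff ℝ (⊤ : ℕ∞) (hermiteSmooth b ψ β) := by
  refine contDiff_infty.2 fun n => ?_
  induction n generalizing β with
  | zero =>
    exact contDiff_zero.2 (continuous_iff_continuousAt.2 fun x =>
      (hasFDerivAt_hermiteSmooth b hψm hψ β x).continuousAt)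
  | succ n ih =>
    exact contDiff_succ_iff_hasFDerivAt.2
      ⟨_, ContDiff.sum fun i _ => (ih (β + Pi.single i 1)).smul contDiff_const,
        hasFDerivAt_hermiteSmooth b hψm hψ β⟩

lemma pderivE_hermiteSmooth {d : ℕ} (b : ℝ) {ψ : Euc d → ℝ} (hψm : Measurable ψ) {C : ℝ}
    (hψ : ∀ x, |ψ x| ≤ C) (β : Fin d → ℕ) (i : Fin d) :
    pderivE i (hermiteSmooth b ψ β) = hermiteSmooth b ψ (β + Pi.single i 1) := by
  ext x
  rw [pderivE, (hasFDerivAt_hermiteSmooth b hψm hψ β x).fderiv]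
  simp

lemma iterate_pderivE_hermiteSmooth {d : ℕ} (b : ℝ) {ψ : Euc d → ℝ} (hψm : Measurable ψ) {C : ℝ}
    (hψ : ∀ x, |ψ x| ≤ C) (β : Fin d → ℕ) (i : Fin d) (k : ℕ) :
    (pderivE i)^[k] (hermiteSmooth b ψ β) = hermiteSmooth b ψ (β + Pi.single i k) := by
  induction k with
  | zero => simp
  | succ k ih =>
    rw [Function.iterate_succ_apply', ih, pderivE_hermiteSmooth b hψm hψ, Pi.single_add, add_assoc]

lemma mderivE_hermiteSmooth {d : ℕ} (b : ℝ) {ψ : Euc d → ℝ} (hψm : Measurable ψ) {C : ℝ}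
    (hψ : ∀ x, |ψ x| ≤ C) (α β : Fin d → ℕ) :
    mderivE α (hermiteSmooth b ψ β) = hermiteSmooth b ψ (β + α) := by
  have h (L : List (Fin d)) :
      ((L.map fun i => (pderivE i)^[α i]).foldr (· ∘ ·) id) (hermiteSmooth b ψ β) =
        hermiteSmooth b ψ (β + (L.map fun i => Pi.single i (α i)).sum) := by
    induction L with
    | nil => simp
    | cons i L ih =>
      simp only [List.map_cons, List.foldr_cons, Function.comp_apply, List.sum_cons]
      rw [ih, iterate_pderivE_hermiteSmooth b hψm hψ, add_assoc, add_comm (Pi.single i _)]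
  rw [mderivE, List.ofFn_eq_map, h, ← List.ofFn_eq_map, List.sum_ofFn, Finset.univ_sum_single]

lemma integral_stdGaussian_s16 {d : ℕ} (g : Euc d → ℝ) :
    ∫ y, g y ∂(_root_.stdGaussian d) =
      (2 * Real.pi) ^ (-(d : ℝ) / 2) * ∫ y, Real.exp (-‖y‖ ^ 2 / 2) * g y := by
  rw [_root_.stdGaussian, integral_withDensity_eq_integral_toReal_smul (by fun_prop)
    (.of_forall fun _ => ENNReal.ofReal_lt_top), ← integral_const_mul]
  refine integral_congr_ae (.of_forall fun y => ?_)
  simp only [smul_eq_mul]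
  rw [ENNReal.toReal_ofReal (by positivity), mul_assoc]

/-- The Ornstein–Uhlenbeck kernel integrals are smoothings of a dilate of `φ`. -/
lemma hermiteSmooth_eq_integral {d : ℕ} (a s : ℝ) (hs : s ≠ 0) (φ : Euc d → ℝ) (β : Fin d → ℕ)
    (x : Euc d) :
    hermiteSmooth (a / s) (fun u => (2 * Real.pi) ^ (-(d : ℝ) / 2) * φ (s • u)) β x =
      (a / s) ^ mdeg β * ∫ y, hermiteM β y * φ (a • x + s • y) ∂(_root_.stdGaussian d) := by
  rw [hermiteSmooth, integral_stdGaussian_s16, ← integral_const_mul ((2 * Real.pi) ^ (-(d : ℝ) / 2)),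
    ← integral_add_right_eq_self (fun u => (2 * Real.pi) ^ (-(d : ℝ) / 2) * φ (s • u) *
      hermiteGaussM β (u - (a / s) • x)) ((a / s) • x)]
  congr 1
  refine integral_congr_ae (.of_forall fun y => ?_)
  simp only [add_sub_cancel_right, hermiteGaussM_eq, smul_add, smul_smul, mul_div_cancel₀ _ hs]
  rw [add_comm (s • y)]
  ring

theorem OU_deriv_hermite_formula
    {d : ℕ} (t : ℝ) (ht : 0 < t)
    (φ : Euc d → ℝ) (hφm : Measurable φ) (hφb : ∃ C : ℝ, ∀ x, |φ x| ≤ C)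
    (α : Fin d → ℕ) :
    ContDiff ℝ (⊤ : ℕ∞) (OU t φ) ∧
      ∀ x : Euc d, mderivE α (OU t φ) x =
        (Real.exp (2 * t) - 1) ^ (-(mdeg α : ℝ) / 2) *
          ∫ y, hermiteM α y *
            φ (Real.exp (-t) • x + Real.sqrt (1 - Real.exp (-2 * t)) • y) ∂(stdGaussian d) := by
  set a := Real.exp (-t)
  set s := Real.sqrt (1 - Real.exp (-2 * t)) with hs_def
  have hpos : 0 < 1 - Real.exp (-2 * t) := by
    have : Real.exp (-2 * t) < 1 := Real.exp_lt_one_iff.2 (by linarith)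
    linarith
  have hs : 0 < s := Real.sqrt_pos.2 hpos
  have hE : 0 < Real.exp (2 * t) - 1 := by
    have : 1 < Real.exp (2 * t) := Real.one_lt_exp_iff.2 (by linarith)
    linarith
  have hb : a / s = (Real.exp (2 * t) - 1) ^ (-(1 : ℝ) / 2) := by
    rw [neg_div, Real.rpow_neg hE.le, ← Real.sqrt_eq_rpow, div_eq_iff hs.ne', inv_mul_eq_div,
      eq_div_iff (Real.sqrt_pos.2 hE).ne', hs_def]
    have ha : a = Real.sqrt (a ^ 2) := (Real.sqrt_sq (Real.exp_pos _).le).symm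
    rw [ha, ← Real.sqrt_mul (sq_nonneg a)]
    congr 1
    rw [← Real.exp_nat_mul, mul_sub, ← Real.exp_add]
    norm_num
  obtain ⟨C, hC⟩ := hφb
  set c : ℝ := (2 * Real.pi) ^ (-(d : ℝ) / 2)
  have hψm : Measurable fun u : Euc d => c * φ (s • u) :=
    (hφm.comp (measurable_const_smul s)).const_mul c
  have hψ (u : Euc d) : |c * φ (s • u)| ≤ |c| * C := by
    rw [abs_mul]
    gcongr
    exact hC _
  have hOU : OU t φ = hermiteSmooth (a / s) (fun u => c * φ (s • u)) 0 := by
    ext x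
    rw [hermiteSmooth_eq_integral a s hs.ne']
    simp [OU, mdeg, hermiteM, hermiteR, a, s]
  refine ⟨hOU ▸ contDiff_hermiteSmooth _ hψm hψ 0, fun x => ?_⟩
  rw [hOU, mderivE_hermiteSmooth _ hψm hψ, zero_add, hermiteSmooth_eq_integral a s hs.ne', hb,
    ← Real.rpow_mul_natCast hE.le]
  congr 2
  ring

end
end
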